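/- arXiv:1902.00850 — 3 statements merged into one kernel-verified Lean document; each statement's English description precedes it below -/
import Mathlib

section
/- Let 0 < α < 1 and ε > 0. For continuous functions φ, ψ : [0,t] → ℝ, |∫_0^t φ(s) (I^α ψ)(s) ds| ≤ Q_1^α(φ,t)/(4ε(1-α)^2) + ε Q_1^α(ψ,t), where Q_1^α(φ,t) = ∫_0^t φ(s) (I^α φ)(s) ds and I^α is the Riemann–Liouville fractional integral. -/
open MeasureTheory

noncomputable def omega (μ t : ℝ) : ℝ := t ^ (μ - 1) / Real.Gamma μ

noncomputable def RL (μ : ℝ) (φ : ℝ → ℝ) (t : ℝ) : ℝ :=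
  ∫ s in (0:ℝ)..t, omega μ (t - s) * φ s

/-- The quadratic functional `Q_1^α(φ,t) = ∫_0^t φ (I^α φ) ds`. -/
noncomputable def Q1 (α : ℝ) (φ : ℝ → ℝ) (t : ℝ) : ℝ :=
  ∫ s in (0:ℝ)..t, φ s * RL α φ s

open Set ProbabilityTheory

theorem beta_integral {a b : ℝ} (ha : 0 < a) (hb : 0 < b) :
    IntegrableOn (fun x : ℝ => x ^ (a - 1) * (1 - x) ^ (b - 1)) (Ioo 0 1) ∧
      ∫ x in Ioo (0 : ℝ) 1, x ^ (a - 1) * (1 - x) ^ (b - 1) = beta a b := by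
  have hc : IntegrableOn (fun x : ℝ => (x : ℂ) ^ ((a : ℂ) - 1) * (1 - (x : ℂ)) ^ ((b : ℂ) - 1))
      (Ioo 0 1) :=
    ((intervalIntegrable_iff_integrableOn_Ioo_of_le zero_le_one).1
      (Complex.betaIntegral_convergent (u := a) (v := b) (by simpa) (by simpa)))
  have heq : ∀ x ∈ Ioo (0 : ℝ) 1,
      ((x : ℂ) ^ ((a : ℂ) - 1) * (1 - (x : ℂ)) ^ ((b : ℂ) - 1)).re
        = x ^ (a - 1) * (1 - x) ^ (b - 1) := by
    intro x hx
    rw [← Complex.ofReal_re (x ^ (a - 1) * (1 - x) ^ (b - 1)), Complex.ofReal_mul,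
      Complex.ofReal_cpow hx.1.le, Complex.ofReal_cpow (by linarith [hx.2])]
    push_cast
    rfl
  refine ⟨IntegrableOn.congr_fun hc.re heq measurableSet_Ioo, ?_⟩
  rw [beta_eq_betaIntegralReal a b ha hb, Complex.betaIntegral,
    intervalIntegral.integral_of_le zero_le_one, integral_Ioc_eq_integral_Ioo,
    ← setIntegral_congr_fun measurableSet_Ioo heq]
  exact integral_re hc

/-- The one-sided power kernel `x₊ ^ (β - 1)`. -/
noncomputable def powKernel (β : ℝ) : ℝ → ℝ := (Ioi 0).indicator fun x => x ^ (β - 1)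

theorem powKernel_of_pos {β x : ℝ} (hx : 0 < x) : powKernel β x = x ^ (β - 1) :=
  indicator_of_mem (mem_Ioi.2 hx) _

theorem powKernel_of_nonpos {β x : ℝ} (hx : x ≤ 0) : powKernel β x = 0 :=
  indicator_of_notMem (by simpa using hx) _

theorem powKernel_nonneg (β x : ℝ) : 0 ≤ powKernel β x :=
  indicator_nonneg (fun _ hx => Real.rpow_nonneg (le_of_lt hx) _) x

@[fun_prop]
theorem measurable_powKernel (β : ℝ) : Measurable (powKernel β) :=
  (by fun_prop : Measurable fun x : ℝ => x ^ (β - 1)).indicator measurableSet_Ioi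

theorem powKernel_mul {β d : ℝ} (hd : 0 < d) (x : ℝ) :
    powKernel β (d * x) = d ^ (β - 1) * powKernel β x := by
  rcases le_or_gt x 0 with hx | hx
  · rw [powKernel_of_nonpos hx, powKernel_of_nonpos (mul_nonpos_of_nonneg_of_nonpos hd.le hx),
      mul_zero]
  · rw [powKernel_of_pos hx, powKernel_of_pos (mul_pos hd hx), Real.mul_rpow hd.le hx.le]

theorem integral_powKernel_conv {β : ℝ} (hβ : 0 < β) (s r : ℝ) :
    Integrable (fun x => powKernel β (s - x) * powKernel β (x - r)) ∧
      ∫ x, powKernel β (s - x) * powKernel β (x - r)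
        = beta β β * powKernel (2 * β) (s - r) := by
  rcases le_or_gt s r with h | h
  · have h0 : ∀ x, powKernel β (s - x) * powKernel β (x - r) = 0 := by
      intro x
      rcases le_or_gt x r with hx | hx
      · rw [powKernel_of_nonpos (x := x - r) (by linarith), mul_zero]
      · rw [powKernel_of_nonpos (x := s - x) (by linarith), zero_mul]
    simp [h0, powKernel_of_nonpos (sub_nonpos.2 h)]
  have hd : 0 < s - r := sub_pos.2 h
  obtain ⟨hint, hval⟩ := beta_integral hβ hβ
  set G : ℝ → ℝ := (Ioo 0 1).indicator fun x : ℝ => x ^ (β - 1) * (1 - x) ^ (β - 1) with hG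
  have hGi : Integrable G := (integrable_indicator_iff measurableSet_Ioo).2 hint
  have hGv : ∫ x, G x = beta β β := by rw [hG, integral_indicator measurableSet_Ioo, hval]
  have hGk : ∀ y, G y = powKernel β y * powKernel β (1 - y) := by
    intro y
    by_cases hy : y ∈ Ioo (0 : ℝ) 1
    · rw [hG, indicator_of_mem hy, powKernel_of_pos hy.1, powKernel_of_pos (by linarith [hy.2])]
    · rw [hG, indicator_of_notMem hy]
      rcases le_or_gt y 0 with h0 | h0
      · rw [powKernel_of_nonpos h0, zero_mul]
      · have : 1 ≤ y := by
          by_contra! h1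
          exact hy ⟨h0, h1⟩
        rw [powKernel_of_nonpos (x := 1 - y) (by linarith), mul_zero]
  have key : (fun x => powKernel β (s - x) * powKernel β (x - r)) =
      fun x => ((s - r) ^ (β - 1)) ^ 2 * G ((x - r) / (s - r)) := by
    funext x
    rw [hGk, show s - x = (s - r) * (1 - (x - r) / (s - r)) by field_simp; ring, powKernel_mul hd]
    conv_lhs => rw [show x - r = (s - r) * ((x - r) / (s - r)) by field_simp, powKernel_mul hd]
    field_simp
  rw [key]
  refine ⟨((hGi.comp_div hd.ne').comp_sub_right r).const_mul _, ?_⟩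
  rw [integral_const_mul, integral_sub_right_eq_self (fun x => G (x / (s - r))) r,
    Measure.integral_comp_div, hGv, powKernel_of_pos hd, smul_eq_mul, abs_of_pos hd,
    ← Real.rpow_natCast, ← Real.rpow_mul hd.le]
  have : (s - r) ^ (2 * β - 1) = (s - r) ^ ((β - 1) * (2 : ℕ)) * (s - r) := by
    rw [← Real.rpow_add_one hd.ne']
    congr 1
    push_cast
    ring
  rw [this]
  ring

theorem integral_powKernel_corr_of_lt {β : ℝ} (hβ : 0 < β) (hβ' : 2 * β < 1) {s r : ℝ}
    (h : r < s) :
    Integrable (fun x => powKernel β (x - s) * powKernel β (x - r)) ∧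
      ∫ x, powKernel β (x - s) * powKernel β (x - r)
        = beta (1 - 2 * β) β * powKernel (2 * β) (s - r) := by
  have hd : 0 < s - r := sub_pos.2 h
  obtain ⟨hint, hval⟩ := beta_integral (a := 1 - 2 * β) (b := β) (by linarith) hβ
  set T : ℝ → ℝ := fun z => r + (s - r) / z with hT
  set F : ℝ → ℝ := fun x => powKernel β (x - s) * powKernel β (x - r) with hF
  have himg : T '' Ioo 0 1 = Ioi s := by
    ext x
    constructor
    · rintro ⟨z, hz, rfl⟩
      have : s - r < (s - r) / z := by
        rw [lt_div_iff₀ hz.1]; nlinarith [hz.2]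
      simp only [hT, mem_Ioi]; linarith
    · intro hx
      have hx : s < x := hx
      have hxr : 0 < x - r := by linarith
      refine ⟨(s - r) / (x - r), ⟨by positivity, by rw [div_lt_one hxr]; linarith⟩, ?_⟩
      simp only [hT]; field_simp; ring
  have hinj : InjOn T (Ioo 0 1) := by
    intro a ha b hb hab
    have ha0 := ha.1.ne'
    have hb0 := hb.1.ne'
    simp only [hT] at hab
    have := add_left_cancel hab
    field_simp at this
    exact this.symm
  have hder : ∀ z ∈ Ioo (0 : ℝ) 1, HasDerivWithinAt T (-((s - r) / z ^ 2)) (Ioo 0 1) z := by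
    intro z hz
    have h1 := ((hasDerivAt_inv hz.1.ne').const_mul (s - r)).const_add r
    convert! h1.hasDerivWithinAt using 1
    field_simp
  have hpt : ∀ z ∈ Ioo (0 : ℝ) 1, |-((s - r) / z ^ 2)| • F (T z) =
      (s - r) ^ (2 * β - 1) * (z ^ (1 - 2 * β - 1) * (1 - z) ^ (β - 1)) := by
    intro z hz
    have hz0 := hz.1
    have hz1 : 0 < 1 - z := by linarith [hz.2]
    have e1 : T z - s = (s - r) * ((1 - z) / z) := by simp only [hT]; field_simp; ring
    have e2 : T z - r = (s - r) * (1 / z) := by simp only [hT]; ring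
    simp only [hF]
    rw [e1, e2, powKernel_mul hd, powKernel_mul hd, powKernel_of_pos (by positivity),
      powKernel_of_pos (by positivity), abs_neg, abs_of_pos (by positivity), smul_eq_mul,
      Real.div_rpow hz1.le hz0.le, Real.div_rpow zero_le_one hz0.le, Real.one_rpow]
    have e3 : (s - r) ^ (2 * β - 1) = (s - r) ^ (β - 1) * (s - r) ^ (β - 1) * (s - r) := by
      rw [← Real.rpow_add hd, ← Real.rpow_add_one hd.ne']; congr 1; ring
    have e4 : z ^ (1 - 2 * β - 1) * (z ^ 2 * (z ^ (β - 1) * z ^ (β - 1))) = 1 := by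
      rw [← Real.rpow_natCast, ← Real.rpow_add hz0, ← Real.rpow_add hz0, ← Real.rpow_add hz0]
      convert! Real.rpow_zero z using 2
      push_cast
      ring
    have hzp : 0 < z ^ (β - 1) := Real.rpow_pos_of_pos hz0 _
    have e5 : z ^ (1 - 2 * β - 1) = 1 / (z ^ 2 * (z ^ (β - 1) * z ^ (β - 1))) :=
      eq_one_div_of_mul_eq_one_left e4
    rw [e3, e5]
    field_simp
  have hsupp : (Ioi s).indicator F = F := by
    rw [indicator_eq_self]
    intro x hx
    by_contra hxs
    exact hx (by simp only [hF]; rw [powKernel_of_nonpos (by simpa using hxs), zero_mul])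
  constructor
  · rw [← hsupp, integrable_indicator_iff measurableSet_Ioi, ← himg,
      integrableOn_image_iff_integrableOn_abs_deriv_smul measurableSet_Ioo hder hinj,
      integrableOn_congr_fun hpt measurableSet_Ioo]
    exact hint.const_mul _
  · rw [← hsupp, integral_indicator measurableSet_Ioi, ← himg,
      integral_image_eq_integral_abs_deriv_smul measurableSet_Ioo hder hinj,
      setIntegral_congr_fun measurableSet_Ioo hpt, integral_const_mul, hval,
      powKernel_of_pos hd, mul_comm]

theorem integral_powKernel_corr {β : ℝ} (hβ : 0 < β) (hβ' : 2 * β < 1) {s r : ℝ} (h : s ≠ r) :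
    Integrable (fun x => powKernel β (x - s) * powKernel β (x - r)) ∧
      ∫ x, powKernel β (x - s) * powKernel β (x - r)
        = beta (1 - 2 * β) β * (powKernel (2 * β) (s - r) + powKernel (2 * β) (r - s)) := by
  rcases h.lt_or_gt with h | h
  · rw [powKernel_of_nonpos (x := s - r) (by linarith), zero_add]
    simpa only [mul_comm] using integral_powKernel_corr_of_lt hβ hβ' h
  · rw [powKernel_of_nonpos (x := r - s) (by linarith), add_zero]
    exact integral_powKernel_corr_of_lt hβ hβ' h

theorem integral_powKernel_corr_reflect {β : ℝ} (hβ : 0 < β) (hβ' : 2 * β < 1) {s r : ℝ}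
    (h : s ≠ r) :
    Integrable (fun x => powKernel β (s - x) * powKernel β (r - x)) ∧
      ∫ x, powKernel β (s - x) * powKernel β (r - x)
        = beta (1 - 2 * β) β * (powKernel (2 * β) (s - r) + powKernel (2 * β) (r - s)) := by
  obtain ⟨h1, h2⟩ := integral_powKernel_corr hβ hβ' (neg_injective.ne h)
  have e : (fun x => powKernel β (s - x) * powKernel β (r - x)) =
      fun x => (fun y => powKernel β (y - -s) * powKernel β (y - -r)) (-x) := by
    funext x
    simp only [sub_neg_eq_add]
    ring_nf
  rw [e]
  refine ⟨h1.comp_neg, ?_⟩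
  rw [integral_neg_eq_self (fun y => powKernel β (y - -s) * powKernel β (y - -r)), h2]
  ring_nf

theorem integral_mul_eq_integral_prod_kernel {μ ν : Measure ℝ} [SFinite μ] [SFinite ν]
    {a b : ℝ → ℝ → ℝ} {u v : ℝ → ℝ} {K : ℝ × ℝ → ℝ}
    (ha : Measurable (Function.uncurry a)) (hb : Measurable (Function.uncurry b))
    (ha0 : ∀ s x, 0 ≤ a s x) (hb0 : ∀ s x, 0 ≤ b s x)
    (hu : AEStronglyMeasurable u μ) (hv : AEStronglyMeasurable v μ)
    (hK : ∀ᵐ p ∂μ.prod μ, Integrable (fun x => a p.1 x * b p.2 x) ν ∧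
      ∫ x, a p.1 x * b p.2 x ∂ν = K p)
    (hKi : Integrable (fun p => u p.1 * v p.2 * K p) (μ.prod μ)) :
    Integrable (fun x => (∫ s, u s * a s x ∂μ) * ∫ r, v r * b r x ∂μ) ν ∧
      ∫ x, (∫ s, u s * a s x ∂μ) * (∫ r, v r * b r x ∂μ) ∂ν
        = ∫ p, u p.1 * v p.2 * K p ∂μ.prod μ := by
  set H : (ℝ × ℝ) × ℝ → ℝ := fun q => u q.1.1 * v q.1.2 * (a q.1.1 q.2 * b q.1.2 q.2) with hH
  have hmeas : AEStronglyMeasurable H ((μ.prod μ).prod ν) := by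
    have h1 : AEStronglyMeasurable (fun q : (ℝ × ℝ) × ℝ => u q.1.1) ((μ.prod μ).prod ν) :=
      hu.comp_fst.comp_fst
    have h2 : AEStronglyMeasurable (fun q : (ℝ × ℝ) × ℝ => v q.1.2) ((μ.prod μ).prod ν) :=
      hv.comp_snd.comp_fst
    have h3 : Measurable fun q : (ℝ × ℝ) × ℝ => a q.1.1 q.2 :=
      ha.comp (by fun_prop : Measurable fun q : (ℝ × ℝ) × ℝ => (q.1.1, q.2))
    have h4 : Measurable fun q : (ℝ × ℝ) × ℝ => b q.1.2 q.2 :=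
      hb.comp (by fun_prop : Measurable fun q : (ℝ × ℝ) × ℝ => (q.1.2, q.2))
    exact (h1.mul h2).mul (h3.mul h4).aestronglyMeasurable
  have hint : Integrable H ((μ.prod μ).prod ν) := by
    rw [integrable_prod_iff hmeas]
    refine ⟨hK.mono fun p hp => hp.1.const_mul (u p.1 * v p.2), hKi.norm.congr ?_⟩
    filter_upwards [hK] with p hp
    have hKp : 0 ≤ K p := hp.2 ▸ integral_nonneg fun x => mul_nonneg (ha0 _ _) (hb0 _ _)
    simp only [hH, norm_mul _ (a _ _ * b _ _), norm_mul _ (K p)]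
    rw [integral_const_mul, Real.norm_of_nonneg hKp, ← hp.2]
    congr 1
    exact integral_congr_ae (Filter.Eventually.of_forall fun x =>
      (Real.norm_of_nonneg (mul_nonneg (ha0 _ _) (hb0 _ _))).symm)
  have hinner : ∀ x, ∫ p, H (p, x) ∂μ.prod μ =
      (∫ s, u s * a s x ∂μ) * ∫ r, v r * b r x ∂μ := by
    intro x
    rw [← integral_prod_mul (fun s => u s * a s x) fun r => v r * b r x]
    congr 1
    funext p
    simp only [hH]
    ring
  refine ⟨hint.integral_prod_right.congr (Filter.Eventually.of_forall hinner), ?_⟩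
  simp_rw [← hinner]
  rw [← integral_prod_symm H hint, integral_prod H hint]
  refine integral_congr_ae (hK.mono fun p hp => ?_)
  simp only [hH]
  rw [integral_const_mul, hp.2]

theorem ae_prod_fst_ne_snd (μ : Measure ℝ) [SFinite μ] [NullSingletonClass μ] :
    ∀ᵐ p ∂μ.prod μ, p.1 ≠ p.2 := by
  rw [Measure.ae_prod_iff_ae_ae (p := fun p : ℝ × ℝ => p.1 ≠ p.2)
    (measurableSet_eq_fun measurable_fst measurable_snd).compl]
  refine Filter.Eventually.of_forall fun x => ?_
  filter_upwards [Measure.ae_ne μ x] with y hy using hy.symm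

theorem integrable_powKernel_sub {α : ℝ} (hα : 0 < α) (t : ℝ) :
    Integrable (fun p : ℝ × ℝ => powKernel α (p.1 - p.2))
      ((volume.restrict (Ioc 0 t)).prod (volume.restrict (Ioc 0 t))) := by
  have hf : Integrable ((Ioc 0 t).indicator fun _ : ℝ => (1 : ℝ)) :=
    (integrable_indicator_iff measurableSet_Ioc).2 (by simp)
  have hg : Integrable ((Ioc 0 t).indicator fun x : ℝ => x ^ (α - 1)) :=
    (integrable_indicator_iff measurableSet_Ioc).2
      (intervalIntegral.intervalIntegrable_rpow' (by linarith)).1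
  have h := (hf.convolution_integrand (ContinuousLinearMap.mul ℝ ℝ) hg).restrict
    (s := Ioc 0 t ×ˢ Ioc 0 t)
  rw [← Measure.prod_restrict] at h
  refine h.congr ?_
  rw [Measure.prod_restrict]
  filter_upwards [ae_restrict_mem (measurableSet_Ioc.prod measurableSet_Ioc)] with p hp
  obtain ⟨⟨h1, h2⟩, h3, h4⟩ := hp
  rw [ContinuousLinearMap.mul_apply', indicator_of_mem (show p.2 ∈ Ioc 0 t from ⟨h3, h4⟩), one_mul]
  by_cases hp : 0 < p.1 - p.2
  · rw [powKernel_of_pos hp, indicator_of_mem]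
    exact ⟨hp, by linarith⟩
  · rw [powKernel_of_nonpos (not_lt.1 hp), indicator_of_notMem]
    exact fun h => hp h.1

theorem integrable_mul_powKernel {α t : ℝ} (hα : 0 < α) {u v : ℝ → ℝ}
    (hu : ContinuousOn u (Icc 0 t)) (hv : ContinuousOn v (Icc 0 t)) :
    Integrable (fun p : ℝ × ℝ => u p.1 * v p.2 * powKernel α (p.1 - p.2))
      ((volume.restrict (Ioc 0 t)).prod (volume.restrict (Ioc 0 t))) := by
  obtain ⟨M, hM⟩ := isCompact_Icc.exists_bound_of_continuousOn hu
  obtain ⟨N, hN⟩ := isCompact_Icc.exists_bound_of_continuousOn hv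
  have hum := (hu.mono Ioc_subset_Icc_self).aestronglyMeasurable (μ := volume) measurableSet_Ioc
  have hvm := (hv.mono Ioc_subset_Icc_self).aestronglyMeasurable (μ := volume) measurableSet_Ioc
  refine (integrable_powKernel_sub hα t).bdd_mul (c := M * N) (hum.comp_fst.mul hvm.comp_snd) ?_
  rw [Measure.prod_restrict]
  filter_upwards [ae_restrict_mem (measurableSet_Ioc.prod measurableSet_Ioc)] with p hp
  have h1 := hM _ (Ioc_subset_Icc_self hp.1)
  have h2 := hN _ (Ioc_subset_Icc_self hp.2)
  rw [norm_mul]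
  exact mul_le_mul h1 h2 (norm_nonneg _) ((norm_nonneg _).trans h1)

theorem integral_mul_RL {α t : ℝ} (hα : 0 < α) (ht : 0 ≤ t) {u v : ℝ → ℝ}
    (hu : ContinuousOn u (Icc 0 t)) (hv : ContinuousOn v (Icc 0 t)) :
    ∫ s in (0 : ℝ)..t, u s * RL α v s =
      (∫ p, u p.1 * v p.2 * powKernel α (p.1 - p.2)
        ∂(volume.restrict (Ioc 0 t)).prod (volume.restrict (Ioc 0 t))) / Real.Gamma α := by
  rw [integral_prod _ (integrable_mul_powKernel hα hu hv), intervalIntegral.integral_of_le ht,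
    ← integral_div]
  refine setIntegral_congr_fun measurableSet_Ioc fun s hs => ?_
  simp only [RL, omega, mul_assoc]
  rw [integral_const_mul, mul_div_assoc, ← integral_div, intervalIntegral.integral_of_le hs.1.le,
    integral_Ioc_eq_integral_Ioo]
  congr 1
  have hsub : Ioo 0 s ⊆ Ioc 0 t := fun r hr => ⟨hr.1, hr.2.le.trans hs.2⟩
  rw [setIntegral_eq_of_subset_of_forall_sdiff_eq_zero measurableSet_Ioc hsub]
  · refine setIntegral_congr_fun measurableSet_Ioo fun r hr => ?_
    rw [powKernel_of_pos (sub_pos.2 hr.2)]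
    ring
  · intro r hr
    have : s ≤ r := by
      by_contra! h
      exact hr.2 ⟨hr.1.1, h⟩
    rw [powKernel_of_nonpos (sub_nonpos.2 this), mul_zero, zero_div]

theorem two_mul_one_sub_mul_beta_le {α : ℝ} (hα0 : 0 < α) (hα1 : α < 1) :
    2 * (1 - α) * beta (1 - α) (α / 2) ≤ beta (α / 2) (α / 2) := by
  have hcos : 1 - α ≤ Real.cos (Real.pi * (α / 2)) := by
    have h := Real.one_sub_mul_le_cos (x := Real.pi * (α / 2)) (by positivity)
      (by nlinarith [Real.pi_pos])
    convert h using 1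
    field_simp
  have hs : 0 < Real.sin (Real.pi * (α / 2)) :=
    Real.sin_pos_of_pos_of_lt_pi (by positivity) (by nlinarith [Real.pi_pos])
  have hc : 0 < Real.cos (Real.pi * (α / 2)) := by linarith
  have h1 := Real.Gamma_mul_Gamma_one_sub α
  have h2 := Real.Gamma_mul_Gamma_one_sub (α / 2)
  rw [show Real.pi * α = 2 * (Real.pi * (α / 2)) by ring, Real.sin_two_mul] at h1
  have g1 : 0 < Real.Gamma α := Real.Gamma_pos_of_pos hα0
  have g2 : 0 < Real.Gamma (1 - α) := Real.Gamma_pos_of_pos (by linarith)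
  have g3 : 0 < Real.Gamma (α / 2) := Real.Gamma_pos_of_pos (by linarith)
  have g4 : 0 < Real.Gamma (1 - α / 2) := Real.Gamma_pos_of_pos (by linarith)
  rw [beta, beta, show 1 - α + α / 2 = 1 - α / 2 by ring, add_halves]
  rw [eq_div_iff (by positivity)] at h1 h2
  have h3 : 2 * Real.cos (Real.pi * (α / 2)) * (Real.Gamma (1 - α) * Real.Gamma α) =
      Real.Gamma (α / 2) * Real.Gamma (1 - α / 2) :=
    mul_right_cancel₀ hs.ne' (by linarith)
  rw [mul_div_assoc', div_le_div_iff₀ g4 g1]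
  have h4 : 2 * (1 - α) * (Real.Gamma (1 - α) * Real.Gamma α) ≤
      Real.Gamma (α / 2) * Real.Gamma (1 - α / 2) := by
    rw [← h3]
    gcongr
  calc _ = 2 * (1 - α) * (Real.Gamma (1 - α) * Real.Gamma α) * Real.Gamma (α / 2) := by ring
    _ ≤ Real.Gamma (α / 2) * Real.Gamma (1 - α / 2) * Real.Gamma (α / 2) := by gcongr
    _ = _ := by ring

theorem integral_mul_powKernel_symm {α t : ℝ} (hα : 0 < α) {u : ℝ → ℝ}
    (hu : ContinuousOn u (Icc 0 t)) (c : ℝ) :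
    Integrable (fun p : ℝ × ℝ => u p.1 * u p.2 *
      (c * (powKernel α (p.1 - p.2) + powKernel α (p.2 - p.1))))
      ((volume.restrict (Ioc 0 t)).prod (volume.restrict (Ioc 0 t))) ∧
    ∫ p, u p.1 * u p.2 * (c * (powKernel α (p.1 - p.2) + powKernel α (p.2 - p.1)))
      ∂(volume.restrict (Ioc 0 t)).prod (volume.restrict (Ioc 0 t)) =
    2 * c * ∫ p, u p.1 * u p.2 * powKernel α (p.1 - p.2)
      ∂(volume.restrict (Ioc 0 t)).prod (volume.restrict (Ioc 0 t)) := by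
  set f : ℝ × ℝ → ℝ := fun p => u p.1 * u p.2 * powKernel α (p.1 - p.2) with hf
  have hi : Integrable f _ := integrable_mul_powKernel hα hu hu
  have hi' : Integrable (fun p : ℝ × ℝ => f p.swap) _ := hi.swap
  have e : (fun p : ℝ × ℝ => u p.1 * u p.2 *
      (c * (powKernel α (p.1 - p.2) + powKernel α (p.2 - p.1)))) =
      fun p => c * (f p + f p.swap) := by
    funext p
    simp only [hf, Prod.fst_swap, Prod.snd_swap]
    ring
  rw [e]
  refine ⟨(hi.add hi').const_mul c, ?_⟩
  rw [integral_const_mul, integral_add hi hi', integral_prod_swap]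
  ring

theorem stmt_2 (α ε t : ℝ) (hα0 : 0 < α) (hα1 : α < 1) (hε : 0 < ε) (ht : 0 ≤ t)
    (φ ψ : ℝ → ℝ) (hφ : ContinuousOn φ (Set.Icc 0 t)) (hψ : ContinuousOn ψ (Set.Icc 0 t)) :
    |∫ s in (0:ℝ)..t, φ s * RL α ψ s| ≤
      Q1 α φ t / (4 * ε * (1 - α) ^ 2) + ε * Q1 α ψ t := by
  set μ := volume.restrict (Ioc 0 t) with hμ
  have hφm : AEStronglyMeasurable φ μ :=
    (hφ.mono Ioc_subset_Icc_self).aestronglyMeasurable measurableSet_Ioc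
  have hψm : AEStronglyMeasurable ψ μ :=
    (hψ.mono Ioc_subset_Icc_self).aestronglyMeasurable measurableSet_Ioc
  have hβ : 0 < α / 2 := by linarith
  have h2β : 2 * (α / 2) = α := by ring
  have hβ' : 2 * (α / 2) < 1 := by linarith
  have hB : 0 < beta (α / 2) (α / 2) := beta_pos hβ hβ
  have hC : 0 < beta (1 - α) (α / 2) := beta_pos (by linarith) hβ
  have hle := two_mul_one_sub_mul_beta_le hα0 hα1
  have hΓ : 0 < Real.Gamma α := Real.Gamma_pos_of_pos hα0
  have hc : 0 < 1 - α := by linarith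
  rw [Q1, Q1, integral_mul_RL hα0 ht hφ hψ, integral_mul_RL hα0 ht hφ hφ,
    integral_mul_RL hα0 ht hψ hψ, ← hμ]
  have hma : Measurable (Function.uncurry fun s x : ℝ => powKernel (α / 2) (s - x)) :=
    (measurable_powKernel _).comp (measurable_fst.sub measurable_snd)
  have hmb : Measurable (Function.uncurry fun r x : ℝ => powKernel (α / 2) (x - r)) :=
    (measurable_powKernel _).comp (measurable_snd.sub measurable_fst)
  obtain ⟨hFGi, hFG⟩ := integral_mul_eq_integral_prod_kernel (ν := volume)
    (K := fun p => beta (α / 2) (α / 2) * powKernel α (p.1 - p.2)) hma hmb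
    (fun _ _ => powKernel_nonneg _ _) (fun _ _ => powKernel_nonneg _ _) hφm hψm
    (Filter.Eventually.of_forall fun p => by
      simpa only [h2β] using integral_powKernel_conv hβ p.1 p.2)
    (((integrable_mul_powKernel hα0 hφ hψ).const_mul (beta (α / 2) (α / 2))).congr
      (Filter.Eventually.of_forall fun p => by ring))
  obtain ⟨hXi, hX⟩ := integral_mul_powKernel_symm hα0 hφ (beta (1 - α) (α / 2))
  obtain ⟨hYi, hY⟩ := integral_mul_powKernel_symm hα0 hψ (beta (1 - α) (α / 2))
  obtain ⟨hFFi, hFF⟩ := integral_mul_eq_integral_prod_kernel (ν := volume) hma hma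
    (fun _ _ => powKernel_nonneg _ _) (fun _ _ => powKernel_nonneg _ _) hφm hφm
    ((ae_prod_fst_ne_snd μ).mono fun p hp => by
      simpa only [h2β] using integral_powKernel_corr_reflect hβ hβ' hp) hXi
  obtain ⟨hGGi, hGG⟩ := integral_mul_eq_integral_prod_kernel (ν := volume) hmb hmb
    (fun _ _ => powKernel_nonneg _ _) (fun _ _ => powKernel_nonneg _ _) hψm hψm
    ((ae_prod_fst_ne_snd μ).mono fun p hp => by
      simpa only [h2β] using integral_powKernel_corr hβ hβ' hp) hYi
  rw [hX] at hFF
  rw [hY] at hGG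
  simp_rw [mul_left_comm _ (beta (α / 2) (α / 2))] at hFG
  rw [integral_const_mul] at hFG
  set X := ∫ p, φ p.1 * φ p.2 * powKernel α (p.1 - p.2) ∂μ.prod μ
  set Y := ∫ p, ψ p.1 * ψ p.2 * powKernel α (p.1 - p.2) ∂μ.prod μ
  set Z := ∫ p, φ p.1 * ψ p.2 * powKernel α (p.1 - p.2) ∂μ.prod μ
  have hX0 : 0 ≤ X := by
    have h : 0 ≤ 2 * beta (1 - α) (α / 2) * X := hFF ▸ integral_nonneg fun x => mul_self_nonneg _
    exact nonneg_of_mul_nonneg_right h (by positivity)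
  have hY0 : 0 ≤ Y := by
    have h : 0 ≤ 2 * beta (1 - α) (α / 2) * Y := hGG ▸ integral_nonneg fun x => mul_self_nonneg _
    exact nonneg_of_mul_nonneg_right h (by positivity)
  have hyoung : ∀ a b : ℝ, |a * b| ≤ 1 / (4 * ε * (1 - α)) * (a * a) + ε * (1 - α) * (b * b) := by
    intro a b
    have hk : 0 < ε * (1 - α) := by positivity
    rw [abs_mul, ← abs_mul_abs_self a, ← abs_mul_abs_self b]
    have h := sq_nonneg (|a| - 2 * (ε * (1 - α)) * |b|)
    rw [← sub_nonneg]
    have e : 1 / (4 * ε * (1 - α)) * (|a| * |a|) + ε * (1 - α) * (|b| * |b|) - |a| * |b| =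
        (|a| - 2 * (ε * (1 - α)) * |b|) ^ 2 / (4 * (ε * (1 - α))) := by
      field_simp
      ring
    rw [e]
    positivity
  have hmain : beta (α / 2) (α / 2) * |Z| ≤
      1 / (4 * ε * (1 - α)) * (2 * beta (1 - α) (α / 2) * X) +
        ε * (1 - α) * (2 * beta (1 - α) (α / 2) * Y) := by
    rw [← abs_of_nonneg hB.le, ← abs_mul, ← hFG, ← hFF, ← hGG, ← integral_const_mul,
      ← integral_const_mul, ← integral_add (hFFi.const_mul _) (hGGi.const_mul _)]
    exact abs_integral_le_integral_abs.trans
      (integral_mono hFGi.abs ((hFFi.const_mul _).add (hGGi.const_mul _)) fun x => hyoung _ _)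
  have hZ : |Z| ≤ X / (4 * ε * (1 - α) ^ 2) + ε * Y := by
    refine le_of_mul_le_mul_left (hmain.trans ?_) hB
    calc _ = 2 * (1 - α) * beta (1 - α) (α / 2) * (X / (4 * ε * (1 - α) ^ 2) + ε * Y) := by
          field_simp
      _ ≤ _ := by gcongr
  rw [abs_div, abs_of_pos hΓ, div_le_iff₀ hΓ]
  refine hZ.trans_eq ?_
  field_simp
end

section
/- Let 0 < α < 1. For a continuous function φ : [0,t] → ℝ, Q_2^α(φ,t) ≤ (2 t^α/(1-α)) Q_1^α(φ,t), where Q_1^α(φ,t) = ∫_0^t φ (I^α φ) ds and Q_2^α(φ,t) = ∫_0^t (I^α φ)^2 ds. -/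
open MeasureTheory

noncomputable def Q2 (α : ℝ) (φ : ℝ → ℝ) (t : ℝ) : ℝ :=
  ∫ s in (0:ℝ)..t, (RL α φ s) ^ 2

/-- The solution of the relaxation equation with rate `lam` and source `φ`, starting from zero
(see `hasDerivAt_relax`). The operator `RL α` is a
superposition of these with the weight `lam ^ (-α)`, see `RL_eq_integral_relax`. -/
noncomputable def relax (φ : ℝ → ℝ) (lam s : ℝ) : ℝ :=
  ∫ r in (0:ℝ)..s, Real.exp (-(lam * (s - r))) * φ r

theorem continuous_relax {φ : ℝ → ℝ} (hφ : Continuous φ) :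
    Continuous (fun p : ℝ × ℝ => relax φ p.1 p.2) := by
  unfold relax
  apply intervalIntegral.continuous_parametric_intervalIntegral_of_continuous
    (f := fun (p : ℝ × ℝ) r => Real.exp (-(p.1 * (p.2 - r))) * φ r)
  · simp only [Function.uncurry_def]
    fun_prop
  · fun_prop

theorem continuous_relax_right {φ : ℝ → ℝ} (hφ : Continuous φ) (lam : ℝ) :
    Continuous (relax φ lam) :=
  (continuous_relax hφ).comp (Continuous.prodMk_right lam)

theorem hasDerivAt_relax {φ : ℝ → ℝ} (hφ : Continuous φ) (lam s : ℝ) :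
    HasDerivAt (relax φ lam) (φ s - lam * relax φ lam s) s := by
  have key : relax φ lam =
      fun s => Real.exp (-(lam * s)) * ∫ r in (0:ℝ)..s, Real.exp (lam * r) * φ r := by
    funext s
    rw [relax, ← intervalIntegral.integral_const_mul]
    congr 1
    funext r
    rw [← mul_assoc, ← Real.exp_add]
    ring_nf
  have hc : Continuous fun r => Real.exp (lam * r) * φ r := by fun_prop
  have h1 := intervalIntegral.integral_hasDerivAt_right (hc.intervalIntegrable 0 s)
    hc.stronglyMeasurable.stronglyMeasurableAtFilter hc.continuousAt
  have h2 : HasDerivAt (fun s => Real.exp (-(lam * s))) (Real.exp (-(lam * s)) * (-lam)) s := by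
    have := ((hasDerivAt_id s).const_mul lam).neg.exp
    simpa using this
  rw [key]
  refine (h2.mul h1).congr_deriv ?_
  have : Real.exp (-(lam * s)) * Real.exp (lam * s) = 1 := by
    rw [← Real.exp_add]; simp
  linear_combination φ s * this

theorem relax_at_zero (φ : ℝ → ℝ) (lam : ℝ) : relax φ lam 0 = 0 := by simp [relax]

theorem abs_relax_le {φ : ℝ → ℝ} (hφ : Continuous φ) {M : ℝ} (hM : ∀ r, |φ r| ≤ M)
    {lam s : ℝ} (hs : 0 ≤ s) :
    |relax φ lam s| ≤ M * ∫ r in (0:ℝ)..s, Real.exp (-(lam * (s - r))) := by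
  rw [relax, ← intervalIntegral.integral_const_mul]
  refine (intervalIntegral.abs_integral_le_integral_abs hs).trans ?_
  refine intervalIntegral.integral_mono_on hs ?_ ?_ ?_
  · exact Continuous.intervalIntegrable (by fun_prop) _ _
  · exact Continuous.intervalIntegrable (by fun_prop) _ _
  · intro r _
    rw [abs_mul, Real.abs_exp, mul_comm]
    gcongr
    exact hM r

theorem abs_relax_le_div_max {φ : ℝ → ℝ} (hφ : Continuous φ) {M : ℝ} (hM : ∀ r, |φ r| ≤ M)
    {lam s T : ℝ} (hs : 0 ≤ s) (hsT : s ≤ T) (hT : 0 < T) (hlam : 0 ≤ lam) :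
    |relax φ lam s| ≤ M / max lam T⁻¹ := by
  have hM0 : 0 ≤ M := (abs_nonneg _).trans (hM 0)
  have hw : 0 < max lam T⁻¹ := lt_max_of_lt_right (inv_pos.2 hT)
  rw [le_div_iff₀ hw]
  have hb := abs_relax_le hφ hM (lam := lam) hs
  set K := ∫ r in (0:ℝ)..s, Real.exp (-(lam * (s - r))) with hK
  suffices h : K * max lam T⁻¹ ≤ 1 by
    calc _ ≤ M * K * max lam T⁻¹ := by gcongr
      _ = M * (K * max lam T⁻¹) := by ring
      _ ≤ M * 1 := by gcongr
      _ = M := mul_one M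
  rcases max_cases lam T⁻¹ with ⟨h, h'⟩ | ⟨h, h'⟩
  · rw [h, hK, ← intervalIntegral.integral_mul_const]
    have hd : ∀ r ∈ Set.uIcc 0 s, HasDerivAt (fun r => Real.exp (-(lam * (s - r))))
        (Real.exp (-(lam * (s - r))) * lam) r := by
      intro r _
      have := ((((hasDerivAt_id r).const_sub s).const_mul lam).neg).exp
      simpa using this
    rw [intervalIntegral.integral_eq_sub_of_hasDerivAt hd
      (Continuous.intervalIntegrable (by fun_prop) _ _)]
    simp [Real.exp_nonneg]
  · rw [h]
    have : K ≤ ∫ r in (0:ℝ)..s, (1:ℝ) := by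
      refine intervalIntegral.integral_mono_on hs
        (Continuous.intervalIntegrable (by fun_prop) _ _) (by simp) ?_
      intro r hr
      rw [Real.exp_le_one_iff, neg_nonpos]
      exact mul_nonneg hlam (sub_nonneg.2 hr.2)
    simp only [intervalIntegral.integral_const, smul_eq_mul, mul_one, sub_zero] at this
    calc K * T⁻¹ ≤ T * T⁻¹ := by gcongr; linarith
      _ = 1 := mul_inv_cancel₀ hT.ne'

theorem mul_integral_relax_sq_le {φ : ℝ → ℝ} (hφ : Continuous φ) (lam T : ℝ) :
    lam * ∫ s in (0:ℝ)..T, relax φ lam s ^ 2 ≤ ∫ s in (0:ℝ)..T, φ s * relax φ lam s := by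
  have hu := continuous_relax_right hφ lam
  have hd : ∀ s ∈ Set.uIcc 0 T, HasDerivAt (fun s => relax φ lam s ^ 2 / 2)
      (φ s * relax φ lam s - lam * relax φ lam s ^ 2) s := by
    intro s _
    refine (((hasDerivAt_relax hφ lam s).pow 2).div_const 2).congr_deriv ?_
    push_cast
    ring
  have h := intervalIntegral.integral_eq_sub_of_hasDerivAt hd
    (Continuous.intervalIntegrable (by fun_prop) _ _)
  rw [intervalIntegral.integral_sub (Continuous.intervalIntegrable (by fun_prop) _ _)
    (Continuous.intervalIntegrable (by fun_prop) _ _), intervalIntegral.integral_const_mul,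
    relax_at_zero] at h
  have := sq_nonneg (relax φ lam T)
  linarith

theorem relax_zero_eq {φ : ℝ → ℝ} (hφ : Continuous φ) (lam s : ℝ) :
    relax φ 0 s = relax φ lam s + lam * ∫ r in (0:ℝ)..s, relax φ lam r := by
  have hu := continuous_relax_right hφ lam
  have h := intervalIntegral.integral_eq_sub_of_hasDerivAt
    (fun r (_ : r ∈ Set.uIcc 0 s) => hasDerivAt_relax hφ lam r)
    (Continuous.intervalIntegrable (by fun_prop) _ _)
  rw [intervalIntegral.integral_sub (Continuous.intervalIntegrable (by fun_prop) _ _)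
    (Continuous.intervalIntegrable (by fun_prop) _ _), intervalIntegral.integral_const_mul,
    relax_at_zero] at h
  have h0 : relax φ 0 s = ∫ r in (0:ℝ)..s, φ r := by simp [relax]
  linarith

theorem hasDerivAt_primitive {u : ℝ → ℝ} (hu : Continuous u) (s : ℝ) :
    HasDerivAt (fun s => ∫ r in (0:ℝ)..s, u r) (u s) s :=
  intervalIntegral.integral_hasDerivAt_right (hu.intervalIntegrable 0 s)
    hu.stronglyMeasurable.stronglyMeasurableAtFilter hu.continuousAt

theorem continuous_primitive {u : ℝ → ℝ} (hu : Continuous u) :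
    Continuous (fun s => ∫ r in (0:ℝ)..s, u r) :=
  continuous_iff_continuousAt.2 fun s => (hasDerivAt_primitive hu s).continuousAt

theorem integral_mul_primitive {u : ℝ → ℝ} (hu : Continuous u) (T : ℝ) :
    ∫ s in (0:ℝ)..T, u s * ∫ r in (0:ℝ)..s, u r = (∫ r in (0:ℝ)..T, u r) ^ 2 / 2 := by
  have hv := continuous_primitive hu
  have hd : ∀ s ∈ Set.uIcc 0 T, HasDerivAt (fun s => (∫ r in (0:ℝ)..s, u r) ^ 2 / 2)
      (u s * ∫ r in (0:ℝ)..s, u r) s := by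
    intro s _
    refine (((hasDerivAt_primitive hu s).pow 2).div_const 2).congr_deriv ?_
    push_cast
    ring
  rw [intervalIntegral.integral_eq_sub_of_hasDerivAt hd
    (Continuous.intervalIntegrable (by fun_prop) _ _)]
  simp

theorem sq_integral_le {u : ℝ → ℝ} (hu : Continuous u) {s : ℝ} (hs : 0 < s) :
    (∫ r in (0:ℝ)..s, u r) ^ 2 ≤ s * ∫ r in (0:ℝ)..s, u r ^ 2 := by
  set v := ∫ r in (0:ℝ)..s, u r with hv
  have h : 0 ≤ ∫ r in (0:ℝ)..s, (s * u r - v) ^ 2 :=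
    intervalIntegral.integral_nonneg hs.le fun r _ => sq_nonneg _
  have e : ∀ r, (s * u r - v) ^ 2 = s ^ 2 * u r ^ 2 - (2 * s * v) * u r + v ^ 2 :=
    fun r => by ring
  simp_rw [e] at h
  rw [intervalIntegral.integral_add (Continuous.intervalIntegrable (by fun_prop) _ _)
    (Continuous.intervalIntegrable (by fun_prop) _ _),
    intervalIntegral.integral_sub (Continuous.intervalIntegrable (by fun_prop) _ _)
    (Continuous.intervalIntegrable (by fun_prop) _ _), intervalIntegral.integral_const_mul,
    intervalIntegral.integral_const_mul, ← hv, intervalIntegral.integral_const] at h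
  simp only [sub_zero, smul_eq_mul] at h
  have h' : 0 ≤ s * (s * (∫ r in (0:ℝ)..s, u r ^ 2) - v ^ 2) := by linarith
  linarith [nonneg_of_mul_nonneg_right h' hs]

theorem integral_relax_zero_sq {φ : ℝ → ℝ} (hφ : Continuous φ) (lam T : ℝ) :
    ∫ s in (0:ℝ)..T, relax φ 0 s ^ 2 = (∫ s in (0:ℝ)..T, relax φ lam s ^ 2)
      + lam * (∫ s in (0:ℝ)..T, relax φ lam s) ^ 2
      + lam ^ 2 * ∫ s in (0:ℝ)..T, (∫ r in (0:ℝ)..s, relax φ lam r) ^ 2 := by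
  have hu := continuous_relax_right hφ lam
  have hv := continuous_primitive hu
  have e : ∀ s, relax φ 0 s ^ 2 = relax φ lam s ^ 2
      + (2 * lam) * (relax φ lam s * ∫ r in (0:ℝ)..s, relax φ lam r)
      + lam ^ 2 * (∫ r in (0:ℝ)..s, relax φ lam r) ^ 2 := by
    intro s
    rw [relax_zero_eq hφ lam s]
    ring
  simp_rw [e]
  rw [intervalIntegral.integral_add (Continuous.intervalIntegrable (by fun_prop) _ _)
    (Continuous.intervalIntegrable (by fun_prop) _ _),
    intervalIntegral.integral_add (Continuous.intervalIntegrable (by fun_prop) _ _)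
    (Continuous.intervalIntegrable (by fun_prop) _ _), intervalIntegral.integral_const_mul,
    intervalIntegral.integral_const_mul, integral_mul_primitive hu]
  ring

theorem integral_relax_sq_le_zero {φ : ℝ → ℝ} (hφ : Continuous φ) {lam T : ℝ}
    (hlam : 0 ≤ lam) (hT : 0 ≤ T) :
    ∫ s in (0:ℝ)..T, relax φ lam s ^ 2 ≤ ∫ s in (0:ℝ)..T, relax φ 0 s ^ 2 := by
  rw [integral_relax_zero_sq hφ lam T]
  have h : 0 ≤ ∫ s in (0:ℝ)..T, (∫ r in (0:ℝ)..s, relax φ lam r) ^ 2 :=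
    intervalIntegral.integral_nonneg hT fun r _ => sq_nonneg _
  have := mul_nonneg hlam (sq_nonneg (∫ s in (0:ℝ)..T, relax φ lam s))
  have := mul_nonneg (sq_nonneg lam) h
  linarith

theorem integral_relax_zero_sq_le {φ : ℝ → ℝ} (hφ : Continuous φ) {lam T : ℝ}
    (hlam : 0 ≤ lam) (hT : 0 < T) :
    ∫ s in (0:ℝ)..T, relax φ 0 s ^ 2 ≤
      (1 + lam * T + (lam * T) ^ 2 / 2) * ∫ s in (0:ℝ)..T, relax φ lam s ^ 2 := by
  rw [integral_relax_zero_sq hφ lam T]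
  have hu := continuous_relax_right hφ lam
  have hv := continuous_primitive hu
  set N := ∫ s in (0:ℝ)..T, relax φ lam s ^ 2 with hN
  have h1 := sq_integral_le hu hT
  have h2 : ∫ s in (0:ℝ)..T, (∫ r in (0:ℝ)..s, relax φ lam r) ^ 2 ≤
      ∫ s in (0:ℝ)..T, s * N := by
    refine intervalIntegral.integral_mono_on hT.le
      (Continuous.intervalIntegrable (by fun_prop) _ _)
      (Continuous.intervalIntegrable (by fun_prop) _ _) ?_
    rintro s ⟨hs0, hsT⟩
    rcases hs0.eq_or_lt with rfl | hs0
    · simp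
    · refine (sq_integral_le hu hs0).trans ?_
      gcongr
      rw [hN]
      refine intervalIntegral.integral_mono_interval le_rfl hs0.le hsT
        (Filter.Eventually.of_forall fun r => sq_nonneg _)
        (Continuous.intervalIntegrable (by fun_prop) _ _)
  rw [intervalIntegral.integral_mul_const, integral_id] at h2
  have := mul_le_mul_of_nonneg_left h1 hlam
  have := mul_le_mul_of_nonneg_left h2 (sq_nonneg lam)
  linarith

open Set in
theorem integral_Ioi_of_eq_rpow {f : ℝ → ℝ} {a b A B δ : ℝ} (hδ : 0 < δ) (ha : -1 < a)
    (hb : b < -1) (h₁ : ∀ x ∈ Ioc 0 δ, f x = A * x ^ a) (h₂ : ∀ x ∈ Ioi δ, f x = B * x ^ b) :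
    IntegrableOn f (Ioi 0) ∧
      ∫ x in Ioi 0, f x = A * (δ ^ (a + 1) / (a + 1)) + B * (-δ ^ (b + 1) / (b + 1)) := by
  have i₁ : IntegrableOn (fun x => A * x ^ a) (Ioc 0 δ) :=
    ((intervalIntegrable_iff_integrableOn_Ioc_of_le hδ.le).1
      (intervalIntegral.intervalIntegrable_rpow' ha)).const_mul A
  have i₂ : IntegrableOn (fun x => B * x ^ b) (Ioi δ) :=
    (integrableOn_Ioi_rpow_of_lt hb hδ).const_mul B
  have j₁ : IntegrableOn f (Ioc 0 δ) :=
    i₁.congr_fun (fun x hx => (h₁ x hx).symm) measurableSet_Ioc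
  have j₂ : IntegrableOn f (Ioi δ) :=
    i₂.congr_fun (fun x hx => (h₂ x hx).symm) measurableSet_Ioi
  rw [← Ioc_union_Ioi_eq_Ioi hδ.le]
  refine ⟨j₁.union j₂, ?_⟩
  rw [setIntegral_union Ioc_disjoint_Ioi_same measurableSet_Ioi j₁ j₂,
    setIntegral_congr_fun measurableSet_Ioc h₁, setIntegral_congr_fun measurableSet_Ioi h₂,
    integral_const_mul, integral_const_mul, integral_Ioi_rpow_of_lt hb hδ,
    ← intervalIntegral.integral_of_le hδ.le, integral_rpow (Or.inl ha),
    Real.zero_rpow (by linarith), sub_zero]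

theorem RL_eq_integral_relax {α : ℝ} (hα0 : 0 < α) (hα1 : α < 1) {φ : ℝ → ℝ}
    (hφ : Continuous φ) {s : ℝ} (hs : 0 < s) :
    RL α φ s = (Real.Gamma α * Real.Gamma (1 - α))⁻¹ *
      ∫ lam in Set.Ioi (0:ℝ), lam ^ (-α) * relax φ lam s := by
  have hΓ := Real.Gamma_pos_of_pos hα0
  have hΓ' := Real.Gamma_pos_of_pos (sub_pos.2 hα1)
  set f : ℝ → ℝ → ℝ := fun r lam => φ r * (lam ^ (-α) * Real.exp (-((s - r) * lam))) with hf
  have hker : ∀ r < s, ∫ lam in Set.Ioi (0:ℝ), lam ^ (-α) * Real.exp (-((s - r) * lam)) =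
      (s - r) ^ (α - 1) * Real.Gamma (1 - α) := by
    intro r hr
    have h := Real.integral_rpow_mul_exp_neg_mul_Ioi (sub_pos.2 hα1) (sub_pos.2 hr)
    rw [one_div, Real.inv_rpow (sub_pos.2 hr).le, ← Real.rpow_neg (sub_pos.2 hr).le] at h
    convert h using 2
    · ring_nf
    · ring_nf
  have hint : ∀ r < s, IntegrableOn
      (fun lam : ℝ => lam ^ (-α) * Real.exp (-((s - r) * lam))) (Set.Ioi 0) := fun r hr =>
    .of_integral_ne_zero (by
      rw [hker r hr]
      exact (mul_pos (Real.rpow_pos_of_pos (sub_pos.2 hr) _) hΓ').ne')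
  have hlt : ∀ᵐ r ∂(volume.restrict (Set.uIoc 0 s)), r < s := by
    rw [Set.uIoc_of_le hs.le, ← restrict_Ioo_eq_restrict_Ioc]
    filter_upwards [ae_restrict_mem measurableSet_Ioo] with r hr using hr.2
  have hsub : IntervalIntegrable (fun r => (s - r) ^ (α - 1)) volume 0 s := by
    have := (intervalIntegral.intervalIntegrable_rpow' (a := 0) (b := s)
      (show -1 < α - 1 by linarith)).comp_sub_left s
    simpa using this.symm
  have hprod : Integrable (Function.uncurry f)
      ((volume.restrict (Set.uIoc 0 s)).prod (volume.restrict (Set.Ioi 0))) := by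
    have hm : Measurable (Function.uncurry f) := by
      have := hφ.measurable
      simp only [hf, Function.uncurry_def]
      fun_prop
    rw [integrable_prod_iff hm.aestronglyMeasurable]
    refine ⟨?_, ?_⟩
    · filter_upwards [hlt] with r hr using (hint r hr).const_mul (φ r)
    · have h1 : IntervalIntegrable (fun r => |φ r| * Real.Gamma (1 - α) * (s - r) ^ (α - 1))
          volume 0 s := hsub.continuousOn_mul (by fun_prop)
      rw [intervalIntegrable_iff] at h1
      refine h1.congr ?_
      filter_upwards [hlt] with r hr
      have : ∀ lam ∈ Set.Ioi (0:ℝ), ‖Function.uncurry f (r, lam)‖ =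
          |φ r| * (lam ^ (-α) * Real.exp (-((s - r) * lam))) := by
        intro lam hl
        simp only [hf, Function.uncurry_def, Real.norm_eq_abs, abs_mul, Real.abs_exp]
        rw [abs_of_nonneg (Real.rpow_nonneg (le_of_lt hl) _)]
      rw [setIntegral_congr_fun measurableSet_Ioi this, integral_const_mul, hker r hr]
      ring
  have hswap := intervalIntegral_integral_swap hprod
  have hL : ∫ r in (0:ℝ)..s, ∫ lam in Set.Ioi (0:ℝ), f r lam =
      (Real.Gamma α * Real.Gamma (1 - α)) * RL α φ s := by
    rw [RL, ← intervalIntegral.integral_const_mul]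
    refine intervalIntegral.integral_congr_ae_restrict ?_
    filter_upwards [hlt] with r hr
    simp only [hf, omega]
    rw [integral_const_mul, hker r hr]
    field_simp
  have hR : ∀ lam, ∫ r in (0:ℝ)..s, f r lam = lam ^ (-α) * relax φ lam s := by
    intro lam
    rw [relax, ← intervalIntegral.integral_const_mul]
    congr 1
    funext r
    simp only [hf]
    rw [mul_comm lam]
    ring
  rw [hL] at hswap
  simp_rw [hR] at hswap
  rw [← hswap, inv_mul_cancel_left₀ (mul_pos hΓ hΓ').ne']

theorem pi_div_four_le_Gamma_mul_Gamma {α : ℝ} (hα0 : 0 < α) (hα1 : α < 1) :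
    Real.pi / 4 ≤ (α * (1 - α)) * (Real.Gamma α * Real.Gamma (1 - α)) := by
  have h := Real.Gamma_mul_add_mul_le_rpow_Gamma_mul_rpow_Gamma
    (show 0 < α + 1 by linarith) (show 0 < (1 - α) + 1 by linarith)
    (show (0:ℝ) < 1 / 2 by norm_num) (show (0:ℝ) < 1 / 2 by norm_num) (by norm_num)
  have hp1 := Real.Gamma_pos_of_pos (show 0 < α + 1 by linarith)
  have hp2 := Real.Gamma_pos_of_pos (show 0 < (1 - α) + 1 by linarith)
  rw [show 1 / 2 * (α + 1) + 1 / 2 * ((1 - α) + 1) = (1 / 2 : ℝ) + 1 by ring,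
    Real.Gamma_add_one (by norm_num), Real.Gamma_one_half_eq,
    ← Real.mul_rpow hp1.le hp2.le, ← Real.sqrt_eq_rpow] at h
  have h2 := pow_le_pow_left₀ (by positivity) h 2
  rw [Real.sq_sqrt (by positivity), mul_pow, Real.sq_sqrt Real.pi_pos.le,
    Real.Gamma_add_one hα0.ne', Real.Gamma_add_one (by linarith)] at h2
  linarith

theorem integral_rpow_div_max {α T : ℝ} (hα0 : 0 < α) (hα1 : α < 1) (hT : 0 < T) :
    IntegrableOn (fun lam : ℝ => lam ^ (-α) / max lam T⁻¹) (Set.Ioi 0) ∧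
      ∫ lam in Set.Ioi (0:ℝ), lam ^ (-α) / max lam T⁻¹ = T ^ α / (α * (1 - α)) := by
  have hδ := inv_pos.2 hT
  have h1α : 1 - α ≠ 0 := (sub_pos.2 hα1).ne'
  have h := integral_Ioi_of_eq_rpow (f := fun lam : ℝ => lam ^ (-α) / max lam T⁻¹)
    (a := -α) (b := -α - 1) (A := T) (B := 1) hδ (by linarith) (by linarith)
    (fun x hx => by rw [max_eq_right hx.2, div_inv_eq_mul, mul_comm])
    (fun x hx => by
      rw [max_eq_left (le_of_lt hx), Real.rpow_sub_one (hδ.trans hx).ne', one_mul])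
  refine ⟨h.1, h.2.trans ?_⟩
  rw [sub_add_cancel, Real.rpow_add_one hδ.ne', Real.inv_rpow hT.le, Real.rpow_neg hT.le, inv_inv]
  have : -α + 1 ≠ 0 := by linarith
  have := hα0.ne'
  field_simp
  ring

theorem integrable_prod_of_le_rpow_div_max {α T C : ℝ} (hα0 : 0 < α) (hα1 : α < 1) (hT : 0 < T)
    {F : ℝ → ℝ → ℝ} (hF : Measurable (Function.uncurry F))
    (hb : ∀ s ∈ Set.Ioc 0 T, ∀ lam ∈ Set.Ioi (0:ℝ), |F s lam| ≤ C * (lam ^ (-α) / max lam T⁻¹)) :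
    Integrable (Function.uncurry F)
      ((volume.restrict (Set.uIoc 0 T)).prod (volume.restrict (Set.Ioi 0))) := by
  rw [Set.uIoc_of_le hT.le]
  have hG := ((integral_rpow_div_max hα0 hα1 hT).1.const_mul C).comp_snd
    (volume.restrict (Set.Ioc 0 T))
  refine hG.mono' hF.aestronglyMeasurable ?_
  rw [Measure.prod_restrict]
  filter_upwards [ae_restrict_mem (measurableSet_Ioc.prod measurableSet_Ioi)] with p hp
  exact hb p.1 hp.1 p.2 hp.2

/-- The squared `L²` norm of `relax φ lam` on `[0, T]`. -/
noncomputable def relaxEnergy (φ : ℝ → ℝ) (T lam : ℝ) : ℝ :=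
  ∫ s in (0:ℝ)..T, relax φ lam s ^ 2

theorem relaxEnergy_nonneg (φ : ℝ → ℝ) {T : ℝ} (hT : 0 ≤ T) (lam : ℝ) :
    0 ≤ relaxEnergy φ T lam :=
  intervalIntegral.integral_nonneg hT fun _ _ => sq_nonneg _

theorem measurable_relax {φ : ℝ → ℝ} (hφ : Continuous φ) :
    Measurable (fun p : ℝ × ℝ => relax φ p.2 p.1) :=
  (continuous_relax hφ).measurable.comp measurable_swap

theorem integrable_max_mul_relax_sq {α T M : ℝ} (hα0 : 0 < α) (hα1 : α < 1) (hT : 0 < T)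
    {φ : ℝ → ℝ} (hφ : Continuous φ) (hM : ∀ r, |φ r| ≤ M) :
    Integrable (Function.uncurry fun s lam : ℝ => lam ^ (-α) * (max lam T⁻¹ * relax φ lam s ^ 2))
      ((volume.restrict (Set.uIoc 0 T)).prod (volume.restrict (Set.Ioi 0))) := by
  refine integrable_prod_of_le_rpow_div_max (C := M ^ 2) hα0 hα1 hT ?_ ?_
  · have := measurable_relax hφ
    simp only [Function.uncurry_def]
    fun_prop
  · intro s hs lam hl
    have hw : 0 < max lam T⁻¹ := lt_max_of_lt_left hl
    have hlα : 0 ≤ lam ^ (-α) := Real.rpow_nonneg (le_of_lt hl) _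
    have hb := abs_relax_le_div_max hφ hM hs.1.le hs.2 hT (le_of_lt hl)
    rw [abs_of_nonneg (by positivity), ← sq_abs]
    calc _ ≤ lam ^ (-α) * (max lam T⁻¹ * (M / max lam T⁻¹) ^ 2) := by gcongr
      _ = _ := by field_simp

theorem integrableOn_max_mul_relaxEnergy {α T M : ℝ} (hα0 : 0 < α) (hα1 : α < 1) (hT : 0 < T)
    {φ : ℝ → ℝ} (hφ : Continuous φ) (hM : ∀ r, |φ r| ≤ M) :
    IntegrableOn (fun lam : ℝ => lam ^ (-α) * (max lam T⁻¹ * relaxEnergy φ T lam))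
      (Set.Ioi 0) := by
  have h := (integrable_max_mul_relax_sq hα0 hα1 hT hφ hM).integral_prod_right
  refine h.congr (Filter.Eventually.of_forall fun lam => ?_)
  simp only [Function.uncurry_def, relaxEnergy]
  rw [integral_const_mul, integral_const_mul, intervalIntegral.integral_of_le hT.le,
    Set.uIoc_of_le hT.le]

theorem measurable_relaxEnergy {φ : ℝ → ℝ} (hφ : Continuous φ) (T : ℝ) :
    Measurable (relaxEnergy φ T) := by
  have := continuous_relax hφ
  refine Continuous.measurable ?_
  exact intervalIntegral.continuous_parametric_intervalIntegral_of_continuous'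
    (f := fun lam s => relax φ lam s ^ 2) (by simp only [Function.uncurry_def]; fun_prop) 0 T

theorem integrableOn_mul_relaxEnergy {α T M : ℝ} (hα0 : 0 < α) (hα1 : α < 1) (hT : 0 < T)
    {φ : ℝ → ℝ} (hφ : Continuous φ) (hM : ∀ r, |φ r| ≤ M) :
    IntegrableOn (fun lam : ℝ => lam ^ (-α) * (lam * relaxEnergy φ T lam)) (Set.Ioi 0) := by
  refine (integrableOn_max_mul_relaxEnergy hα0 hα1 hT hφ hM).mono' ?_ ?_
  · have := measurable_relaxEnergy hφ T
    exact Measurable.aestronglyMeasurable (by fun_prop)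
  · filter_upwards [ae_restrict_mem measurableSet_Ioi] with lam hl
    have hl : 0 < lam := hl
    have hN := relaxEnergy_nonneg φ hT.le lam
    rw [Real.norm_of_nonneg (by positivity)]
    gcongr
    exact le_max_left _ _

theorem integral_mul_relaxEnergy_le_Q1 {α T M : ℝ} (hα0 : 0 < α) (hα1 : α < 1) (hT : 0 < T)
    {φ : ℝ → ℝ} (hφ : Continuous φ) (hM : ∀ r, |φ r| ≤ M) :
    (Real.Gamma α * Real.Gamma (1 - α))⁻¹ *
      ∫ lam in Set.Ioi (0:ℝ), lam ^ (-α) * (lam * relaxEnergy φ T lam) ≤ Q1 α φ T := by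
  have hΓ := Real.Gamma_pos_of_pos hα0
  have hΓ' := Real.Gamma_pos_of_pos (sub_pos.2 hα1)
  have hprod : Integrable
      (Function.uncurry fun s lam : ℝ => lam ^ (-α) * (φ s * relax φ lam s))
      ((volume.restrict (Set.uIoc 0 T)).prod (volume.restrict (Set.Ioi 0))) := by
    refine integrable_prod_of_le_rpow_div_max (C := M * M) hα0 hα1 hT ?_ ?_
    · have := measurable_relax hφ
      have := hφ.measurable
      simp only [Function.uncurry_def]
      fun_prop
    · intro s hs lam hl
      have hlα : 0 ≤ lam ^ (-α) := Real.rpow_nonneg (le_of_lt hl) _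
      have hb := abs_relax_le_div_max hφ hM hs.1.le hs.2 hT (le_of_lt hl)
      have hM0 : 0 ≤ M := (abs_nonneg _).trans (hM 0)
      rw [abs_mul, abs_mul, abs_of_nonneg hlα]
      calc _ ≤ lam ^ (-α) * (M * (M / max lam T⁻¹)) := by
            gcongr
            exact hM s
        _ = _ := by ring
  have hQ : Q1 α φ T = (Real.Gamma α * Real.Gamma (1 - α))⁻¹ *
      ∫ lam in Set.Ioi (0:ℝ), ∫ s in (0:ℝ)..T, lam ^ (-α) * (φ s * relax φ lam s) := by
    rw [← intervalIntegral_integral_swap hprod, Q1, ← intervalIntegral.integral_const_mul]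
    refine intervalIntegral.integral_congr_ae_restrict ?_
    filter_upwards [ae_restrict_mem measurableSet_uIoc] with s hs
    rw [Set.uIoc_of_le hT.le] at hs
    rw [RL_eq_integral_relax hα0 hα1 hφ hs.1, mul_left_comm, ← integral_const_mul]
    congr 2
    funext lam
    ring
  rw [hQ]
  gcongr ?_ * ?_
  refine setIntegral_mono_on (integrableOn_mul_relaxEnergy hα0 hα1 hT hφ hM) ?_
    measurableSet_Ioi ?_
  · have h := hprod.integral_prod_right
    simp only [Function.uncurry_def] at h
    simp only [Set.uIoc_of_le hT.le] at h
    simpa only [intervalIntegral.integral_of_le hT.le, IntegrableOn] using h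
  · intro lam hl
    rw [intervalIntegral.integral_const_mul]
    have hlα : 0 ≤ lam ^ (-α) := Real.rpow_nonneg (le_of_lt hl) _
    gcongr
    exact mul_integral_relax_sq_le hφ lam T

theorem sq_integral_relax_le {α T M : ℝ} (hα0 : 0 < α) (hα1 : α < 1) (hT : 0 < T)
    {φ : ℝ → ℝ} (hφ : Continuous φ) (hM : ∀ r, |φ r| ≤ M) {s : ℝ} (hs : s ∈ Set.Ioc 0 T) :
    (∫ lam in Set.Ioi (0:ℝ), lam ^ (-α) * relax φ lam s) ^ 2 ≤ T ^ α / (α * (1 - α)) *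
      ∫ lam in Set.Ioi (0:ℝ), lam ^ (-α) * (max lam T⁻¹ * relax φ lam s ^ 2) := by
  obtain ⟨hG, hG0⟩ := integral_rpow_div_max hα0 hα1 hT
  have hu : Measurable fun lam => relax φ lam s :=
    (measurable_relax hφ).comp measurable_prodMk_left
  have hb : ∀ lam ∈ Set.Ioi (0:ℝ), |relax φ lam s| ≤ M / max lam T⁻¹ := fun lam hl =>
    abs_relax_le_div_max hφ hM hs.1.le hs.2 hT (le_of_lt hl)
  have hA : IntegrableOn (fun lam => lam ^ (-α) * relax φ lam s) (Set.Ioi 0) := by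
    refine (hG.const_mul M).mono' (Measurable.aestronglyMeasurable (by fun_prop)) ?_
    filter_upwards [ae_restrict_mem measurableSet_Ioi] with lam hl
    have hlα : 0 ≤ lam ^ (-α) := Real.rpow_nonneg (le_of_lt hl) _
    rw [Real.norm_eq_abs, abs_mul, abs_of_nonneg hlα]
    calc _ ≤ lam ^ (-α) * (M / max lam T⁻¹) := by
          gcongr
          exact hb lam hl
      _ = _ := by ring
  have hB : IntegrableOn (fun lam => lam ^ (-α) * (max lam T⁻¹ * relax φ lam s ^ 2))
      (Set.Ioi 0) := by
    refine (hG.const_mul (M ^ 2)).mono' (Measurable.aestronglyMeasurable (by fun_prop)) ?_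
    filter_upwards [ae_restrict_mem measurableSet_Ioi] with lam hl
    have hw : 0 < max lam T⁻¹ := lt_max_of_lt_left hl
    have hlα : 0 ≤ lam ^ (-α) := Real.rpow_nonneg (le_of_lt hl) _
    rw [Real.norm_of_nonneg (by positivity), ← sq_abs]
    calc _ ≤ lam ^ (-α) * (max lam T⁻¹ * (M / max lam T⁻¹) ^ 2) := by
          gcongr
          exact hb lam hl
      _ = _ := by field_simp
  have hpos : 0 < T ^ α / (α * (1 - α)) :=
    div_pos (Real.rpow_pos_of_pos hT _) (mul_pos hα0 (sub_pos.2 hα1))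
  set g := T ^ α / (α * (1 - α))
  set A := ∫ lam in Set.Ioi (0:ℝ), lam ^ (-α) * relax φ lam s
  set B := ∫ lam in Set.Ioi (0:ℝ), lam ^ (-α) * (max lam T⁻¹ * relax φ lam s ^ 2)
  have h : 0 ≤ ∫ lam in Set.Ioi (0:ℝ),
      (g ^ 2 * (lam ^ (-α) * (max lam T⁻¹ * relax φ lam s ^ 2))
        - 2 * g * A * (lam ^ (-α) * relax φ lam s) + A ^ 2 * (lam ^ (-α) / max lam T⁻¹)) := by
    refine setIntegral_nonneg measurableSet_Ioi fun lam hl => ?_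
    have hw : 0 < max lam T⁻¹ := lt_max_of_lt_left hl
    have hlα : 0 ≤ lam ^ (-α) := Real.rpow_nonneg (le_of_lt hl) _
    have e : g ^ 2 * (lam ^ (-α) * (max lam T⁻¹ * relax φ lam s ^ 2))
        - 2 * g * A * (lam ^ (-α) * relax φ lam s) + A ^ 2 * (lam ^ (-α) / max lam T⁻¹) =
        lam ^ (-α) / max lam T⁻¹ * (g * max lam T⁻¹ * relax φ lam s - A) ^ 2 := by
      field_simp
      ring
    rw [e]
    positivity
  have hBA : IntegrableOn (fun lam => g ^ 2 * (lam ^ (-α) * (max lam T⁻¹ * relax φ lam s ^ 2))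
      - 2 * g * A * (lam ^ (-α) * relax φ lam s)) (Set.Ioi 0) :=
    (hB.const_mul _).sub (hA.const_mul _)
  rw [integral_add hBA (hG.const_mul _), integral_sub (hB.const_mul _) (hA.const_mul _),
    integral_const_mul, integral_const_mul, integral_const_mul, hG0] at h
  have h' : 0 ≤ g * (g * B - A ^ 2) := by linarith
  linarith [nonneg_of_mul_nonneg_right h' hpos]

theorem Q2_le_integral_max_mul_relaxEnergy {α T M : ℝ} (hα0 : 0 < α) (hα1 : α < 1) (hT : 0 < T)
    {φ : ℝ → ℝ} (hφ : Continuous φ) (hM : ∀ r, |φ r| ≤ M) :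
    Q2 α φ T ≤ ((Real.Gamma α * Real.Gamma (1 - α))⁻¹) ^ 2 * (T ^ α / (α * (1 - α)) *
      ∫ lam in Set.Ioi (0:ℝ), lam ^ (-α) * (max lam T⁻¹ * relaxEnergy φ T lam)) := by
  have hprod := integrable_max_mul_relax_sq hα0 hα1 hT hφ hM
  have hswap : ∫ s in (0:ℝ)..T, ∫ lam in Set.Ioi (0:ℝ),
      lam ^ (-α) * (max lam T⁻¹ * relax φ lam s ^ 2) =
      ∫ lam in Set.Ioi (0:ℝ), lam ^ (-α) * (max lam T⁻¹ * relaxEnergy φ T lam) := by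
    rw [intervalIntegral_integral_swap hprod]
    simp only [intervalIntegral.integral_const_mul, relaxEnergy]
  rw [← hswap, ← intervalIntegral.integral_const_mul, ← intervalIntegral.integral_const_mul, Q2,
    intervalIntegral.integral_of_le hT.le, intervalIntegral.integral_of_le hT.le]
  refine integral_mono_of_nonneg (Filter.Eventually.of_forall fun s => sq_nonneg _) ?_ ?_
  · have h := hprod.integral_prod_left
    rw [Set.uIoc_of_le hT.le] at h
    exact (h.const_mul _).const_mul _
  · filter_upwards [ae_restrict_mem measurableSet_Ioc] with s hs
    rw [RL_eq_integral_relax hα0 hα1 hφ hs.1, mul_pow]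
    gcongr
    exact sq_integral_relax_le hα0 hα1 hT hφ hM hs

theorem relaxEnergy_zero_mul_le {α T M : ℝ} (hα0 : 0 < α) (hα1 : α < 1) (hT : 0 < T)
    {φ : ℝ → ℝ} (hφ : Continuous φ) (hM : ∀ r, |φ r| ≤ M) :
    relaxEnergy φ T 0 * T⁻¹ * T⁻¹ ^ (1 - α) ≤ 5 / 4 * (α * (2 - α)) *
      ∫ lam in Set.Ioi (0:ℝ), lam ^ (-α) * (lam * relaxEnergy φ T lam) := by
  have hδ := inv_pos.2 hT
  set δ := T⁻¹ with hδT
  set N₀ := relaxEnergy φ T 0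
  have hN₀ : 0 ≤ N₀ := relaxEnergy_nonneg φ hT.le 0
  have h := integral_Ioi_of_eq_rpow
    (f := fun lam : ℝ => 2 / 5 * N₀ * (lam ^ (1 - α) * (δ ^ 2 / max lam δ ^ 2)))
    (a := 1 - α) (b := -α - 1) (A := 2 / 5 * N₀) (B := 2 / 5 * N₀ * δ ^ 2)
    hδ (by linarith) (by linarith)
    (fun x hx => by rw [max_eq_right hx.2, div_self (by positivity), mul_one])
    (fun x hx => by
      have hx0 := hδ.trans hx
      rw [max_eq_left (le_of_lt hx), show 1 - α = (-α - 1) + (2 : ℕ) by push_cast; ring,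
        Real.rpow_add_natCast hx0.ne']
      field_simp)
  have hle := setIntegral_mono_on h.1 (integrableOn_mul_relaxEnergy hα0 hα1 hT hφ hM)
    measurableSet_Ioi (by
      intro lam hl
      have hl : 0 < lam := hl
      have hN : N₀ ≤ (1 + lam * T + (lam * T) ^ 2 / 2) * relaxEnergy φ T lam :=
        integral_relax_zero_sq_le hφ hl.le hT
      have hN' := relaxEnergy_nonneg φ hT.le lam
      have hw : 0 < max lam δ := lt_max_of_lt_left hl
      have hq : (1 + lam * T + (lam * T) ^ 2 / 2) * δ ^ 2 ≤ 5 / 2 * max lam δ ^ 2 := by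
        have e : (1 + lam * T + (lam * T) ^ 2 / 2) * δ ^ 2 =
            δ ^ 2 + lam * δ + lam ^ 2 / 2 := by
          rw [hδT]
          field_simp
        rw [e]
        have h1 := le_max_left lam δ
        have h2 := le_max_right lam δ
        nlinarith [mul_le_mul h1 h2 hδ.le hw.le, mul_le_mul h1 h1 hl.le hw.le,
          mul_le_mul h2 h2 hδ.le hw.le]
      have hlα : 0 < lam ^ (-α) := Real.rpow_pos_of_pos hl _
      rw [show 1 - α = -α + 1 by ring, Real.rpow_add_one hl.ne']
      have key : 2 / 5 * N₀ * (δ ^ 2 / max lam δ ^ 2) ≤ relaxEnergy φ T lam := by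
        rw [← mul_div_assoc, div_le_iff₀ (by positivity)]
        nlinarith [mul_le_mul_of_nonneg_right hN (sq_nonneg δ),
          mul_le_mul_of_nonneg_left hq hN']
      calc _ = lam ^ (-α) * (lam * (2 / 5 * N₀ * (δ ^ 2 / max lam δ ^ 2))) := by ring
        _ ≤ _ := by gcongr)
  rw [h.2] at hle
  have e1 : δ ^ (1 - α + 1) = δ * δ ^ (1 - α) := by rw [Real.rpow_add_one hδ.ne', mul_comm]
  have e2 : δ ^ (1 - α) = δ * δ ^ (-α) := by
    rw [sub_eq_neg_add, Real.rpow_add_one hδ.ne', mul_comm]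
  have e3 : δ ^ (-α - 1 + 1) = δ ^ (-α) := by rw [sub_add_cancel]
  have h2α : 0 < 2 - α := by linarith
  have hk := mul_le_mul_of_nonneg_left hle (show 0 ≤ 5 / 4 * (α * (2 - α)) by positivity)
  refine le_trans (le_of_eq ?_) hk
  rw [e1, e3, e2, show 1 - α + 1 = 2 - α by ring, show -α - 1 + 1 = -α by ring]
  field_simp
  ring

theorem integral_max_mul_relaxEnergy_le {α T M : ℝ} (hα0 : 0 < α) (hα1 : α < 1) (hT : 0 < T)
    {φ : ℝ → ℝ} (hφ : Continuous φ) (hM : ∀ r, |φ r| ≤ M) :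
    ∫ lam in Set.Ioi (0:ℝ), lam ^ (-α) * (max lam T⁻¹ * relaxEnergy φ T lam) ≤
      (∫ lam in Set.Ioi (0:ℝ), lam ^ (-α) * (lam * relaxEnergy φ T lam)) +
        relaxEnergy φ T 0 * T⁻¹ * T⁻¹ ^ (1 - α) / (1 - α) := by
  have hδ := inv_pos.2 hT
  have hN₀ := relaxEnergy_nonneg φ hT.le 0
  have h := integral_Ioi_of_eq_rpow
    (f := (Set.Ioc 0 T⁻¹).indicator fun lam : ℝ => relaxEnergy φ T 0 * T⁻¹ * lam ^ (-α))
    (a := -α) (b := -2) (A := relaxEnergy φ T 0 * T⁻¹) (B := 0)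
    hδ (by linarith) (by norm_num)
    (fun x hx => Set.indicator_of_mem hx _)
    (fun x hx => by
      rw [Set.indicator_of_notMem (fun h' => not_lt.2 h'.2 hx), zero_mul])
  have hF := integrableOn_mul_relaxEnergy hα0 hα1 hT hφ hM
  rw [zero_mul, add_zero, neg_add_eq_sub, ← mul_div_assoc] at h
  rw [← h.2, ← integral_add hF h.1]
  refine setIntegral_mono_on (integrableOn_max_mul_relaxEnergy hα0 hα1 hT hφ hM) (hF.add h.1)
    measurableSet_Ioi fun lam hl => ?_
  have hl : 0 < lam := hl
  have hlα : 0 < lam ^ (-α) := Real.rpow_pos_of_pos hl _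
  have hN := relaxEnergy_nonneg φ hT.le lam
  have hN' : relaxEnergy φ T lam ≤ relaxEnergy φ T 0 := integral_relax_sq_le_zero hφ hl.le hT.le
  rcases le_or_gt lam T⁻¹ with hc | hc
  · rw [Set.indicator_of_mem (show lam ∈ Set.Ioc 0 T⁻¹ from ⟨hl, hc⟩), max_eq_right hc]
    calc _ ≤ lam ^ (-α) * (T⁻¹ * relaxEnergy φ T 0) := by gcongr
      _ = 0 + relaxEnergy φ T 0 * T⁻¹ * lam ^ (-α) := by ring
      _ ≤ _ := by gcongr; positivity
  · rw [Set.indicator_of_notMem (show lam ∉ Set.Ioc 0 T⁻¹ from fun h' => not_lt.2 h'.2 hc),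
      max_eq_left hc.le, add_zero]

theorem Q2_le_of_continuous {α T M : ℝ} (hα0 : 0 < α) (hα1 : α < 1) (hT : 0 < T)
    {φ : ℝ → ℝ} (hφ : Continuous φ) (hM : ∀ r, |φ r| ≤ M) :
    Q2 α φ T ≤ (2 * T ^ α / (1 - α)) * Q1 α φ T := by
  have h1 := integral_mul_relaxEnergy_le_Q1 hα0 hα1 hT hφ hM
  have h2 := Q2_le_integral_max_mul_relaxEnergy hα0 hα1 hT hφ hM
  have h3 := integral_max_mul_relaxEnergy_le hα0 hα1 hT hφ hM
  have h4 := relaxEnergy_zero_mul_le hα0 hα1 hT hφ hM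
  have hP := pi_div_four_le_Gamma_mul_Gamma hα0 hα1
  have hΓ : 0 < Real.Gamma α * Real.Gamma (1 - α) :=
    mul_pos (Real.Gamma_pos_of_pos hα0) (Real.Gamma_pos_of_pos (sub_pos.2 hα1))
  have hF : 0 ≤ ∫ lam in Set.Ioi (0:ℝ), lam ^ (-α) * (lam * relaxEnergy φ T lam) :=
    setIntegral_nonneg measurableSet_Ioi fun lam hl =>
      mul_nonneg (Real.rpow_nonneg (le_of_lt hl) _)
        (mul_nonneg (le_of_lt hl) (relaxEnergy_nonneg φ hT.le lam))
  set F := ∫ lam in Set.Ioi (0:ℝ), lam ^ (-α) * (lam * relaxEnergy φ T lam)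
  set B := ∫ lam in Set.Ioi (0:ℝ), lam ^ (-α) * (max lam T⁻¹ * relaxEnergy φ T lam)
  set g := Real.Gamma α * Real.Gamma (1 - α)
  have h1α : 0 < 1 - α := sub_pos.2 hα1
  have hTα : 0 < T ^ α := Real.rpow_pos_of_pos hT _
  have hB : B ≤ 2 * (α * g) * F := by
    have hB1 : B ≤ F + 5 / 4 * (α * (2 - α)) * F / (1 - α) := h3.trans (by gcongr)
    have hc : 1 - α + 5 / 4 * (α * (2 - α)) ≤ 2 * (α * g) * (1 - α) := by
      nlinarith [Real.pi_gt_three, Real.pi_gt_d2, sq_nonneg (α - 3 / 5)]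
    refine hB1.trans ?_
    have e : F + 5 / 4 * (α * (2 - α)) * F / (1 - α) =
        (1 - α + 5 / 4 * (α * (2 - α))) / (1 - α) * F := by
      field_simp
    rw [e]
    gcongr
    rwa [div_le_iff₀ h1α]
  calc Q2 α φ T ≤ (g⁻¹) ^ 2 * (T ^ α / (α * (1 - α)) * B) := h2
    _ ≤ (g⁻¹) ^ 2 * (T ^ α / (α * (1 - α)) * (2 * (α * g) * F)) := by gcongr
    _ = (2 * T ^ α / (1 - α)) * (g⁻¹ * F) := by field_simp
    _ ≤ (2 * T ^ α / (1 - α)) * Q1 α φ T := by gcongr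

theorem RL_congr {α s t : ℝ} {φ ψ : ℝ → ℝ} (h : Set.EqOn φ ψ (Set.Icc 0 t))
    (hs : s ∈ Set.Icc 0 t) : RL α φ s = RL α ψ s := by
  refine intervalIntegral.integral_congr fun r hr => ?_
  rw [Set.uIcc_of_le hs.1] at hr
  simp only [h ⟨hr.1, hr.2.trans hs.2⟩]

theorem stmt_3 (α t : ℝ) (hα0 : 0 < α) (hα1 : α < 1) (ht : 0 ≤ t)
    (φ : ℝ → ℝ) (hφ : ContinuousOn φ (Set.Icc 0 t)) :
    Q2 α φ t ≤ (2 * t ^ α / (1 - α)) * Q1 α φ t := by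
  rcases ht.eq_or_lt with rfl | hT
  · simp [Q1, Q2]
  set ψ : ℝ → ℝ := Set.IccExtend ht ((Set.Icc 0 t).domRestrict φ) with hψ
  have hψc : Continuous ψ := hφ.domRestrict.Icc_extend'
  have heq : Set.EqOn φ ψ (Set.Icc 0 t) := fun r hr => by
    rw [hψ, Set.IccExtend_of_mem ht _ hr, Set.domRestrict_apply]
  obtain ⟨M, hM⟩ := isCompact_Icc.exists_bound_of_continuousOn hφ
  have hψM : ∀ r, |ψ r| ≤ M := fun r => hM _ (Set.projIcc 0 t ht r).2
  have e1 : Q1 α φ t = Q1 α ψ t := by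
    refine intervalIntegral.integral_congr fun s hs => ?_
    rw [Set.uIcc_of_le ht] at hs
    simp only [heq hs, RL_congr heq hs]
  have e2 : Q2 α φ t = Q2 α ψ t := by
    refine intervalIntegral.integral_congr fun s hs => ?_
    rw [Set.uIcc_of_le ht] at hs
    simp only [RL_congr heq hs]
  rw [e1, e2]
  exact Q2_le_of_continuous hα0 hα1 hT hψc hψM
end

section
/- (Fractional Gronwall inequality) Let β > 0, T > 0, and let a, b : [0,T] → [0,∞) be non-decreasing. If q : [0,T] → ℝ is integrable and satisfies 0 ≤ q(t) ≤ a(t) + b(t) (I^β q)(t) for all 0 ≤ t ≤ T, then q(t) ≤ a(t) E_β(b(t) t^β) for all 0 ≤ t ≤ T, where E_β is the Mittag–Leffler function E_β(z) = Σ_{k≥0} z^k/Γ(1+kβ). -/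
open MeasureTheory

/-- The one-parameter Mittag–Leffler function `E_β(z) = Σ_{k≥0} z^k / Γ(1+kβ)`. -/
noncomputable def mittagLeffler (β z : ℝ) : ℝ := ∑' k : ℕ, z ^ k / Real.Gamma (1 + k * β)

open scoped ENNReal

lemma rpow_mul_exp_neg_le_Gamma {R x : ℝ} (hR : 0 < R) (hx : 0 ≤ x) :
    R ^ x * Real.exp (-R) ≤ Real.Gamma (1 + x) := by
  rw [Real.Gamma_eq_integral (by linarith), ← integral_exp_neg_Ioi R, ← integral_const_mul]
  have hint := Real.GammaIntegral_convergent (s := 1 + x) (by linarith)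
  have hsub : Set.Ioi R ⊆ Set.Ioi 0 := Set.Ioi_subset_Ioi hR.le
  calc ∫ s in Set.Ioi R, R ^ x * Real.exp (-s)
      ≤ ∫ s in Set.Ioi R, Real.exp (-s) * s ^ (1 + x - 1) := by
        refine setIntegral_mono_on ((integrableOn_exp_neg_Ioi R).const_mul _)
          (hint.mono_set hsub) measurableSet_Ioi fun s hs => ?_
        rw [add_sub_cancel_left, mul_comm]
        have : R ≤ s := le_of_lt hs
        gcongr
    _ ≤ ∫ s in Set.Ioi 0, Real.exp (-s) * s ^ (1 + x - 1) := by
        refine setIntegral_mono_set hint ?_ hsub.eventuallyLE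
        refine ae_restrict_of_forall_mem measurableSet_Ioi fun s hs => ?_
        have : (0 : ℝ) < s := hs
        positivity

lemma summable_mittagLeffler {β : ℝ} (hβ : 0 < β) (z : ℝ) :
    Summable fun k : ℕ => z ^ k / Real.Gamma (1 + k * β) := by
  set c : ℝ := 2 * |z| + 1
  have hc : 0 < c := by positivity
  set R : ℝ := c ^ β⁻¹
  have hR : 0 < R := by positivity
  have hRβ : R ^ β = c := Real.rpow_inv_rpow hc.le hβ.ne'
  have hzc : |z| / c < 1 := by
    rw [div_lt_one hc]
    have := abs_nonneg z
    linarith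
  refine Summable.of_norm_bounded
    ((summable_geometric_of_lt_one (by positivity) hzc).mul_left (Real.exp R)) fun k => ?_
  have hG : 0 < Real.Gamma (1 + k * β) := Real.Gamma_pos_of_pos (by positivity)
  have hle := rpow_mul_exp_neg_le_Gamma hR (x := k * β) (by positivity)
  rw [mul_comm (k : ℝ) β, Real.rpow_mul hR.le, hRβ, Real.rpow_natCast, mul_comm β] at hle
  rw [norm_div, norm_pow, Real.norm_eq_abs, Real.norm_eq_abs, abs_of_pos hG]
  calc |z| ^ k / Real.Gamma (1 + k * β) ≤ |z| ^ k / (c ^ k * Real.exp (-R)) := by gcongr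
    _ = Real.exp R * (|z| / c) ^ k := by
      rw [Real.exp_neg, div_pow]
      field_simp

/-- The fractional kernel `omega μ`, extended by zero to the nonpositive half-line and regarded as
an extended nonnegative function. -/
noncomputable def fracKernel (μ t : ℝ) : ℝ≥0∞ :=
  if 0 < t then ENNReal.ofReal (omega μ t) else 0

lemma fracKernel_of_pos (μ : ℝ) {t : ℝ} (ht : 0 < t) :
    fracKernel μ t = ENNReal.ofReal (omega μ t) := if_pos ht

lemma fracKernel_of_nonpos (μ : ℝ) {t : ℝ} (ht : t ≤ 0) : fracKernel μ t = 0 := if_neg ht.not_gt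

lemma omega_nonneg {μ t : ℝ} (hμ : 0 < μ) (ht : 0 ≤ t) : 0 ≤ omega μ t :=
  div_nonneg (Real.rpow_nonneg ht _) (Real.Gamma_pos_of_pos hμ).le

@[fun_prop]
lemma measurable_fracKernel (μ : ℝ) : Measurable (fracKernel μ) := by
  unfold fracKernel omega
  exact Measurable.ite measurableSet_Ioi (by fun_prop) (by fun_prop)

lemma mul_fracKernel_mul_fracKernel {α β x : ℝ} (hα : 0 < α) (hβ : 0 < β) (hx : 0 < x) (u : ℝ) :
    ENNReal.ofReal x * (fracKernel α (x * u) * fracKernel β (-(x * u) + x)) =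
      fracKernel (α + β) x * ProbabilityTheory.betaPDF α β u := by
  rcases le_or_gt u 0 with hu | hu
  · rw [ProbabilityTheory.betaPDF_eq_zero_of_nonpos hu,
      fracKernel_of_nonpos α (mul_nonpos_of_nonneg_of_nonpos hx.le hu)]
    simp
  rcases le_or_gt 1 u with hu1 | hu1
  · rw [ProbabilityTheory.betaPDF_eq_zero_of_one_le hu1,
      fracKernel_of_nonpos β (by nlinarith)]
    simp
  have h1u : 0 < 1 - u := by linarith
  have hxu : -(x * u) + x = x * (1 - u) := by ring
  rw [hxu, ProbabilityTheory.betaPDF_of_pos_lt_one hu hu1, fracKernel_of_pos _ (mul_pos hx hu),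
    fracKernel_of_pos _ (mul_pos hx h1u), fracKernel_of_pos _ hx,
    ← ENNReal.ofReal_mul (omega_nonneg hα (by positivity)), ← ENNReal.ofReal_mul hx.le,
    ← ENNReal.ofReal_mul (omega_nonneg (by positivity) hx.le)]
  congr 1
  have h1 := Real.Gamma_pos_of_pos hα
  have h2 := Real.Gamma_pos_of_pos hβ
  have h3 := Real.Gamma_pos_of_pos (add_pos hα hβ)
  have hpow : x ^ (α + β - 1) = x * (x ^ (α - 1) * x ^ (β - 1)) := by
    rw [show α + β - 1 = 1 + ((α - 1) + (β - 1)) by ring, Real.rpow_add hx, Real.rpow_add hx,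
      Real.rpow_one]
  simp only [omega, ProbabilityTheory.beta]
  rw [Real.mul_rpow hx.le hu.le, Real.mul_rpow hx.le h1u.le, hpow]
  field_simp

lemma lintegral_eq_mul_lintegral_comp_mul_left {x : ℝ} (hx : 0 < x) {f : ℝ → ℝ≥0∞}
    (hf : Measurable f) : ∫⁻ y, f y = ENNReal.ofReal x * ∫⁻ u, f (x * u) := by
  rw [← lintegral_map hf (measurable_const_mul x), Real.map_volume_mul_left hx.ne',
    lintegral_smul_measure, smul_eq_mul, ← mul_assoc, ← ENNReal.ofReal_mul hx.le,
    abs_of_pos (inv_pos.2 hx), mul_inv_cancel₀ hx.ne', ENNReal.ofReal_one, one_mul]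

lemma fracKernel_lconvolution_fracKernel {α β : ℝ} (hα : 0 < α) (hβ : 0 < β) :
    fracKernel α ⋆ₗ fracKernel β = fracKernel (α + β) := by
  ext x
  rw [lconvolution_def]
  rcases le_or_gt x 0 with hx | hx
  · rw [fracKernel_of_nonpos _ hx, lintegral_eq_zero_iff (by fun_prop)]
    refine Filter.Eventually.of_forall fun y => ?_
    rcases le_or_gt y 0 with hy | hy
    · simp [fracKernel_of_nonpos α hy]
    · simp [fracKernel_of_nonpos β (show -y + x ≤ 0 by linarith)]
  · rw [lintegral_eq_mul_lintegral_comp_mul_left hx (by fun_prop),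
      ← lintegral_const_mul _ (by fun_prop)]
    simp_rw [mul_fracKernel_mul_fracKernel hα hβ hx]
    rw [lintegral_const_mul' _ _ (by rw [fracKernel_of_pos _ hx]; exact ENNReal.ofReal_ne_top),
      ProbabilityTheory.lintegral_betaPDF_eq_one hα hβ, mul_one]

lemma lconvolution_le_of_le_add {k f g h : ℝ → ℝ≥0∞} {A B : ℝ≥0∞} (hk : Measurable k)
    (hg : Measurable g) (hh : AEMeasurable h) (hle : ∀ s, f s ≤ A * g s + B * h s) (t : ℝ) :
    (k ⋆ₗ f) t ≤ A * (k ⋆ₗ g) t + B * (k ⋆ₗ h) t := by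
  have hshift : AEMeasurable fun y => h (-y + t) :=
    hh.comp_quasiMeasurePreserving (by
      simpa [neg_add_eq_sub] using quasiMeasurePreserving_sub_left volume t)
  simp only [lconvolution_def]
  rw [← lintegral_const_mul _ (by fun_prop),
    ← lintegral_const_mul'' _ (by fun_prop), ← lintegral_add_left (by fun_prop)]
  refine lintegral_mono fun y => ?_
  calc k y * f (-y + t) ≤ k y * (A * g (-y + t) + B * h (-y + t)) := by
        gcongr
        exact hle _
    _ = _ := by ring

/-- Iterating the Volterra inequality `f ≤ A + B I^β f`. -/
lemma le_sum_add_lconvolution {β : ℝ} (hβ : 0 < β) {A B : ℝ≥0∞}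
    {f : ℝ → ℝ≥0∞} (hf : AEMeasurable f)
    (h : ∀ s, f s ≤ A * fracKernel 1 s + B * (fracKernel β ⋆ₗ f) s) (n : ℕ) (t : ℝ) :
    f t ≤ ∑ k ∈ Finset.range (n + 1), A * B ^ k * fracKernel (1 + k * β) t +
      B ^ (n + 1) * (fracKernel ((n + 1 : ℕ) * β) ⋆ₗ f) t := by
  induction n with
  | zero => simpa using h t
  | succ n ih =>
    refine ih.trans ?_
    rw [Finset.sum_range_succ _ (n + 1), add_assoc]
    gcongr ?_ + ?_
    · exact le_rfl
    set α : ℝ := (n + 1 : ℕ) * β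
    have hα : 0 < α := by positivity
    have hconv : (fracKernel α ⋆ₗ f) t ≤
        A * fracKernel (1 + α) t + B * (fracKernel ((n + 1 + 1 : ℕ) * β) ⋆ₗ f) t := by
      have hαβ : ((n + 1 + 1 : ℕ) : ℝ) * β = α + β := by simp only [α]; push_cast; ring
      rw [hαβ, ← fracKernel_lconvolution_fracKernel hα hβ,
        ← lconvolution_assoc₀ (by fun_prop) (by fun_prop) hf, add_comm 1 α,
        ← fracKernel_lconvolution_fracKernel hα one_pos]
      exact lconvolution_le_of_le_add (by fun_prop) (by fun_prop)
        (aemeasurable_lconvolution (by fun_prop) hf) h t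
    calc B ^ (n + 1) * (fracKernel α ⋆ₗ f) t
        ≤ B ^ (n + 1) * (A * fracKernel (1 + α) t +
          B * (fracKernel ((n + 1 + 1 : ℕ) * β) ⋆ₗ f) t) := by gcongr
      _ = _ := by ring

lemma fracKernel_lconvolution_le {α t : ℝ} (hα : 1 ≤ α) {f : ℝ → ℝ≥0∞}
    (hf0 : ∀ s ≤ 0, f s = 0) :
    (fracKernel α ⋆ₗ f) t ≤ ENNReal.ofReal (omega α t) * ∫⁻ s, f s := by
  rw [lconvolution_comm, lconvolution_def, ← lintegral_const_mul' _ _ ENNReal.ofReal_ne_top]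
  refine lintegral_mono fun s => ?_
  rw [mul_comm]
  rcases le_or_gt s 0 with hs | hs
  · simp [hf0 s hs]
  rcases le_or_gt (-s + t) 0 with hst | hst
  · simp [fracKernel_of_nonpos α hst]
  rw [fracKernel_of_pos _ hst]
  have hG := Real.Gamma_pos_of_pos (show 0 < α by linarith)
  unfold omega
  gcongr
  linarith

lemma tendsto_pow_mul_omega {β B t : ℝ} (hβ : 0 < β) (ht : 0 < t) :
    Filter.Tendsto (fun n : ℕ => B ^ (n + 1) * omega ((n + 1 : ℕ) * β) t)
      Filter.atTop (nhds 0) := by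
  set z := B * t ^ β
  have hlim : Filter.Tendsto (fun m : ℕ => (β / t) * ((2 * |z|) ^ m / Real.Gamma (1 + m * β)))
      Filter.atTop (nhds 0) := by
    simpa using (summable_mittagLeffler hβ (2 * |z|)).tendsto_atTop_zero.const_mul (β / t)
  refine squeeze_zero_norm (fun n => ?_) (hlim.comp (Filter.tendsto_add_atTop_nat 1))
  set m : ℕ := n + 1
  have hm : (0 : ℝ) < m := by simp only [m]; positivity
  have hG : 0 < Real.Gamma (m * β) := Real.Gamma_pos_of_pos (by positivity)
  have hG1 : Real.Gamma (1 + m * β) = m * β * Real.Gamma (m * β) := by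
    rw [add_comm, Real.Gamma_add_one (by positivity)]
  have heq : B ^ m * omega (m * β) t = (β / t) * (m * z ^ m / Real.Gamma (1 + m * β)) := by
    rw [omega, Real.rpow_sub ht, Real.rpow_one, mul_comm (m : ℝ) β, Real.rpow_mul ht.le,
      Real.rpow_natCast, mul_comm β, hG1, mul_pow]
    field_simp
  have h2 : (m : ℝ) ≤ 2 ^ m := by exact_mod_cast Nat.lt_two_pow_self.le
  have hG1' : 0 < Real.Gamma (1 + m * β) := by rw [hG1]; positivity
  rw [heq, norm_mul, norm_div, norm_div, norm_mul, norm_pow]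
  simp only [Real.norm_eq_abs, Function.comp_apply, abs_of_pos hβ, abs_of_pos ht, abs_of_pos hm,
    abs_of_pos hG1', mul_pow]
  gcongr

lemma ofReal_RL_le_lconvolution {β s : ℝ} (hβ : 0 < β) (hs : 0 ≤ s) {q : ℝ → ℝ} {f : ℝ → ℝ≥0∞}
    (hf : ∀ r ∈ Set.Ioo 0 s, ‖q r‖ₑ ≤ f r) :
    ENNReal.ofReal (RL β q s) ≤ (fracKernel β ⋆ₗ f) s := by
  rw [lconvolution_comm, lconvolution_def, RL, intervalIntegral.integral_of_le hs,
    integral_Ioc_eq_integral_Ioo]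
  refine (Real.ofReal_le_enorm _).trans <| (enorm_integral_le_lintegral_enorm _).trans ?_
  refine le_trans (setLIntegral_mono' measurableSet_Ioo fun r hr => ?_)
    (setLIntegral_le_lintegral (Set.Ioo 0 s) _)
  have hrs : 0 < s - r := sub_pos.2 hr.2
  rw [enorm_mul, mul_comm, neg_add_eq_sub, fracKernel_of_pos _ hrs,
    Real.enorm_of_nonneg (omega_nonneg hβ hrs.le)]
  gcongr
  exact hf r hr

lemma sum_fracKernel_le_mittagLeffler {β A B t : ℝ} (hβ : 0 < β) (hA : 0 ≤ A) (hB : 0 ≤ B)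
    (ht : 0 < t) (n : ℕ) :
    ∑ k ∈ Finset.range n, ENNReal.ofReal A * ENNReal.ofReal B ^ k * fracKernel (1 + k * β) t ≤
      ENNReal.ofReal (A * mittagLeffler β (B * t ^ β)) := by
  have hG (k : ℕ) : 0 < Real.Gamma (1 + k * β) := Real.Gamma_pos_of_pos (by positivity)
  have hterm (k : ℕ) :
      ENNReal.ofReal A * ENNReal.ofReal B ^ k * fracKernel (1 + k * β) t =
        ENNReal.ofReal (A * ((B * t ^ β) ^ k / Real.Gamma (1 + k * β))) := by
    rw [fracKernel_of_pos _ ht, ← ENNReal.ofReal_pow hB, ← ENNReal.ofReal_mul hA,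
      ← ENNReal.ofReal_mul (by positivity), omega, add_sub_cancel_left, mul_comm (k : ℝ) β,
      Real.rpow_mul ht.le, Real.rpow_natCast, mul_pow]
    congr 1
    ring
  have hnonneg (k : ℕ) : 0 ≤ (B * t ^ β) ^ k / Real.Gamma (1 + k * β) :=
    div_nonneg (by positivity) (hG k).le
  simp_rw [hterm]
  rw [← ENNReal.ofReal_sum_of_nonneg fun k _ => mul_nonneg hA (hnonneg k), ← Finset.mul_sum]
  gcongr
  exact (summable_mittagLeffler hβ _).sum_le_tsum _ fun k _ => hnonneg k

/-- Fractional Gronwall inequality. -/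
theorem stmt_9 (β T : ℝ) (hβ : 0 < β) (hT : 0 < T)
    (a b q : ℝ → ℝ)
    (ha0 : ∀ s ∈ Set.Icc (0:ℝ) T, 0 ≤ a s) (hb0 : ∀ s ∈ Set.Icc (0:ℝ) T, 0 ≤ b s)
    (ha : MonotoneOn a (Set.Icc 0 T)) (hb : MonotoneOn b (Set.Icc 0 T))
    (hq : IntegrableOn q (Set.Icc 0 T))
    (hineq : ∀ t ∈ Set.Icc (0:ℝ) T, 0 ≤ q t ∧ q t ≤ a t + b t * RL β q t) :
    ∀ t ∈ Set.Icc (0:ℝ) T, q t ≤ a t * mittagLeffler β (b t * t ^ β) := by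
  intro t ht
  rcases ht.1.eq_or_lt with rfl | htpos
  · have hML : mittagLeffler β 0 = 1 := by
      rw [mittagLeffler, tsum_eq_single 0 fun k hk => by simp [hk]]
      simp
    simpa [RL, Real.zero_rpow hβ.ne', hML] using (hineq 0 ht).2
  have hA := ha0 t ht
  have hB := hb0 t ht
  set f : ℝ → ℝ≥0∞ := (Set.Ioc 0 t).indicator fun s => ‖q s‖ₑ with hf_def
  have hqt : IntegrableOn q (Set.Ioc 0 t) :=
    hq.mono_set (Set.Ioc_subset_Icc_self.trans (Set.Icc_subset_Icc_right ht.2))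
  have hf : AEMeasurable f :=
    (aemeasurable_indicator_iff measurableSet_Ioc).2 hqt.aestronglyMeasurable.enorm
  have hf_fin : ∫⁻ s, f s ≠ ∞ := by
    rw [hf_def, lintegral_indicator measurableSet_Ioc]
    exact hqt.2.ne
  have hvolterra (s : ℝ) : f s ≤ ENNReal.ofReal (a t) * fracKernel 1 s +
      ENNReal.ofReal (b t) * (fracKernel β ⋆ₗ f) s := by
    by_cases hs : s ∈ Set.Ioc 0 t
    · have hsT : s ∈ Set.Icc 0 T := ⟨hs.1.le, hs.2.trans ht.2⟩
      rw [hf_def, Set.indicator_of_mem hs, ← hf_def, Real.enorm_of_nonneg (hineq s hsT).1,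
        fracKernel_of_pos _ hs.1]
      have hRL : ENNReal.ofReal (RL β q s) ≤ (fracKernel β ⋆ₗ f) s :=
        ofReal_RL_le_lconvolution hβ hs.1.le fun r hr => by
          rw [hf_def, Set.indicator_of_mem (show r ∈ Set.Ioc 0 t from
            ⟨hr.1, hr.2.le.trans hs.2⟩)]
      have hω : omega 1 s = 1 := by simp [omega]
      rw [hω, ENNReal.ofReal_one, mul_one]
      calc ENNReal.ofReal (q s) ≤ ENNReal.ofReal (a s + b s * RL β q s) :=
            ENNReal.ofReal_le_ofReal (hineq s hsT).2
        _ ≤ ENNReal.ofReal (a s) + ENNReal.ofReal (b s) * ENNReal.ofReal (RL β q s) := by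
            rw [← ENNReal.ofReal_mul (hb0 s hsT)]
            exact ENNReal.ofReal_add_le
        _ ≤ _ := by
            gcongr
            · exact ha hsT ht hs.2
            · exact hb hsT ht hs.2
    · rw [hf_def, Set.indicator_of_notMem hs]
      exact zero_le
  have hrem : Filter.Tendsto (fun n : ℕ => ENNReal.ofReal (a t * mittagLeffler β (b t * t ^ β)) +
      ENNReal.ofReal (b t ^ (n + 1) * omega ((n + 1 : ℕ) * β) t) * ∫⁻ s, f s) Filter.atTop
      (nhds (ENNReal.ofReal (a t * mittagLeffler β (b t * t ^ β)))) := by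
    have h0 := ENNReal.Tendsto.mul_const
      (ENNReal.tendsto_ofReal (tendsto_pow_mul_omega (B := b t) hβ htpos)) (Or.inr hf_fin)
    simpa using h0.const_add (ENNReal.ofReal (a t * mittagLeffler β (b t * t ^ β)))
  have hlarge : ∀ᶠ n : ℕ in Filter.atTop, 1 ≤ ((n + 1 : ℕ) : ℝ) * β :=
    ((tendsto_natCast_atTop_atTop.comp (Filter.tendsto_add_atTop_nat 1)).atTop_mul_const
      hβ).eventually_ge_atTop 1
  have hmain : f t ≤ ENNReal.ofReal (a t * mittagLeffler β (b t * t ^ β)) := by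
    refine ge_of_tendsto hrem (hlarge.mono fun n hn => ?_)
    refine (le_sum_add_lconvolution hβ hf hvolterra n t).trans ?_
    gcongr ?_ + ?_
    · exact sum_fracKernel_le_mittagLeffler hβ hA hB htpos _
    · rw [ENNReal.ofReal_mul (by positivity), ENNReal.ofReal_pow hB, mul_assoc]
      gcongr
      refine fracKernel_lconvolution_le hn fun s hs => ?_
      exact Set.indicator_of_notMem (fun h => h.1.not_ge hs) _
  rw [hf_def, Set.indicator_of_mem (Set.right_mem_Ioc.2 htpos),
    Real.enorm_of_nonneg (hineq t ht).1] at hmain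
  refine (ENNReal.ofReal_le_ofReal_iff (mul_nonneg hA (tsum_nonneg fun k => ?_))).1 hmain
  exact div_nonneg (pow_nonneg (by positivity) k) (Real.Gamma_pos_of_pos (by positivity)).le
end
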